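/- For any smoothly embedded compact, orientable, boundaryless surface S in ℝ³, the manifold M(S) is irreducible: every embedded two-sphere S' contained in the interior of M(S) bounds an embedded three-ball inside the interior of M(S). -/

import Mathlib

noncomputable section

open Metric Set Filter Topology
open scoped ENNReal NNReal

/-! ### Basic model spaces -/

/-- Euclidean three-space. -/
abbrev R3 := EuclideanSpace ℝ (Fin 3)
/-- Euclidean two-space. -/
abbrev R2 := EuclideanSpace ℝ (Fin 2)
/-- The two-torus `𝕋² = 𝕊¹ × 𝕊¹`. -/
abbrev Torus2 := Circle × Circle
/-- The closed unit two-disc. -/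
abbrev Disc2 := {z : ℂ // ‖z‖ ≤ 1}
/-- The (closed) solid torus `B̄² × 𝕊¹`. -/
abbrev SolidTorusT := Disc2 × Circle
/-- The closed unit three-ball. -/
abbrev Ball3 := {x : R3 // ‖x‖ ≤ 1}
/-- The unit two-sphere. -/
abbrev Sphere2 := {x : R3 // ‖x‖ = 1}

/-! ### Abstract Riemannian data

Mathlib has no Ricci curvature or Riemannian volume, so we record abstractly,
for a Riemannian metric `g` on `M`: the induced length distance `d`, the
Riemannian volume `vol` of subsets, and at each point the smallest and largest
eigenvalues `ricciLo`, `ricciHi` of the Ricci tensor (w.r.t. `g`). -/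
structure RiemData (M : Type*) where
  d : M → M → ℝ
  d_self : ∀ p, d p p = 0
  d_comm : ∀ p q, d p q = d q p
  d_triangle : ∀ p q r, d p r ≤ d p q + d q r
  d_eq_zero : ∀ p q, d p q = 0 → p = q
  vol : Set M → ℝ
  vol_nonneg : ∀ s, 0 ≤ vol s
  vol_mono : ∀ s t, s ⊆ t → vol s ≤ vol t
  ricciLo : M → ℝ
  ricciHi : M → ℝ
  lo_le_hi : ∀ p, ricciLo p ≤ ricciHi p

namespace RiemData

variable {M : Type*} (g : RiemData M)

/-- Geodesic ball of the metric. -/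
def ball (o : M) (r : ℝ) : Set M := {p | g.d o p < r}

/-- Open geodesic annulus `A_g(a,b) = B_g(o,b) ∖ closure (B_g(o,a))`. -/
def ann (o : M) (a b : ℝ) : Set M := {p | a < g.d o p ∧ g.d o p < b}

/-- Metric completeness of the distance `d` (every Cauchy sequence converges). -/
def Complete : Prop :=
  ∀ s : ℕ → M, (∀ ε > 0, ∃ N, ∀ m ≥ N, ∀ n ≥ N, g.d (s m) (s n) < ε) →
    ∃ p, ∀ ε > 0, ∃ N, ∀ n ≥ N, g.d (s n) p < ε

/-- `d` is a length (intrinsic) distance: approximate midpoints exist. -/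
def LengthDist : Prop :=
  ∀ p q, ∀ ε > 0, ∃ m, g.d p m ≤ g.d p q / 2 + ε ∧ g.d m q ≤ g.d p q / 2 + ε

end RiemData

/-- For a Riemannian metric on `ℝ³`: the topology induced by the Riemannian
distance is the standard topology of `ℝ³`. -/
def RiemData.Compatible (g : RiemData R3) : Prop :=
  (∀ p : R3, ∀ ε > 0, ∃ δ > 0, ∀ q, ‖q - p‖ < δ → g.d p q < ε) ∧
  (∀ p : R3, ∀ ε > 0, ∃ δ > 0, ∀ q, g.d p q < δ → ‖q - p‖ < ε)

/-! ### Gromov–Hausdorff distance, following the definition in the paper: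
metrics on the disjoint union extending both metrics, with each space in the
`δ`-neighbourhood of the other. -/

/-- There is a metric on `X ⊔ Y` extending the two distances for which `X` and
`Y` are mutually within (closed) distance `δ`; `dist_GH (X,Y) ≤ δ'` for every
`δ' > δ`. -/
def IsGHApprox (X : Type*) (Y : Type*) [PseudoMetricSpace X] [PseudoMetricSpace Y]
    (δ : ℝ) : Prop :=
  ∃ D : (X ⊕ Y) → (X ⊕ Y) → ℝ,
    (∀ a, D a a = 0) ∧ (∀ a b, 0 ≤ D a b) ∧ (∀ a b, D a b = D b a) ∧
    (∀ a b c, D a c ≤ D a b + D b c) ∧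
    (∀ x x' : X, D (.inl x) (.inl x') = dist x x') ∧
    (∀ y y' : Y, D (.inr y) (.inr y') = dist y y') ∧
    (∀ x : X, ∃ y : Y, D (.inl x) (.inr y) ≤ δ) ∧
    (∀ y : Y, ∃ x : X, D (.inl x) (.inr y) ≤ δ)

/-- The Gromov–Hausdorff distance between `X` and `Y` is at most `c`. -/
def GHDistLE (X : Type*) (Y : Type*) [PseudoMetricSpace X] [PseudoMetricSpace Y]
    (c : ℝ) : Prop :=
  ∀ δ, c < δ → IsGHApprox X Y δ

/-- The Gromov–Hausdorff distance between `X` and `Y` is at least `c`. -/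
def GHDistGE (X : Type*) (Y : Type*) [PseudoMetricSpace X] [PseudoMetricSpace Y]
    (c : ℝ) : Prop :=
  ∀ δ, IsGHApprox X Y δ → c ≤ δ

/-- A compact interval `[0,l]` of the real line with the standard distance. -/
abbrev IccSp (l : ℝ) := Set.Icc (0:ℝ) l

/-! ### Intrinsic distance, radius, curve lengths -/

/-- Length of a path, as the total variation of the parametrization. -/
def pathLength {X : Type*} [PseudoMetricSpace X] {p q : X} (γ : Path p q) : ℝ≥0∞ :=
  eVariationOn γ Set.univ

/-- Intrinsic (inner) distance of the region `Ω ⊆ X`: infimum of lengths of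
paths joining `p` to `q` inside `Ω`. -/
def intrinsicDist {X : Type*} [MetricSpace X] (Ω : Set X) (p q : X) : ℝ≥0∞ :=
  ⨅ (γ : Path p q) (_ : Set.range γ ⊆ Ω), pathLength γ

/-- The radius (to the boundary) `rad(Ω) = sup_{p ∈ Ω} d^Ω(p, ∂Ω)`. -/
def radius {X : Type*} [MetricSpace X] (Ω : Set X) : ℝ≥0∞ :=
  ⨆ (p : X) (_ : p ∈ Ω), ⨅ (q : X) (_ : q ∈ frontier Ω), intrinsicDist Ω p q

/-! ### Flat tori -/

/-- `T` is (isometric to) a flat two-torus: a quotient of Euclidean `ℝ²` by a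
lattice spanned by two independent vectors, with the quotient distance. -/
def IsFlatTorus (T : Type*) [MetricSpace T] : Prop :=
  ∃ v₁ v₂ : R2, LinearIndependent ℝ ![v₁, v₂] ∧
    ∃ π : R2 → T, Function.Surjective π ∧
      ∀ x y : R2, dist (π x) (π y) =
        Metric.infDist (x - y) ((AddSubgroup.closure {v₁, v₂} : AddSubgroup R2) : Set R2)

/-! ### Manifolds with (non-necessarily smooth) boundary, as metric spaces

An abstract compact Riemannian three-manifold with non-necessarily smooth
boundary is recorded as a metric space (the distance `d^M_g`), a distinguished
boundary set, the total Riemannian volume, and pointwise Ricci eigenvalue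
bounds. -/
structure RMB where
  X : Type
  [ms : MetricSpace X]
  bdry : Set X
  vol : ℝ
  ricciLo : X → ℝ
  ricciHi : X → ℝ

attribute [instance] RMB.ms

namespace RMB

variable (M : RMB)

/-- The manifold interior `M° = M ∖ ∂M`. -/
def interiorPts : Set M.X := M.bdryᶜ

/-- The tubular neighbourhood `𝒯_d(∂M, ε)` of the boundary. -/
def tnb (ε : ℝ) : Set M.X := {p | Metric.infDist p M.bdry < ε}

/-- `|Ric| ≤ Λ` everywhere. -/
def RicBddBy (Λ : ℝ) : Prop := ∀ p : M.X, -Λ ≤ M.ricciLo p ∧ M.ricciHi p ≤ Λ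

end RMB

/-- Membership in the class `ℳ(𝔑₀)`: for all `1 > ε₀ > 2ε₁ > 0`, the set
`M ∖ 𝒯(∂M,ε₀)` can be covered by at most `𝔑₀(ε₀,ε₁)` geodesic balls of radius
`ε₁` (balls centred at points at distance `> ε₁` from the boundary). -/
def InClassM (N : ℝ → ℝ → ℝ) (M : RMB) : Prop :=
  ∀ ε₀ ε₁ : ℝ, ε₀ < 1 → 2 * ε₁ < ε₀ → 0 < ε₁ →
    ∃ s : Finset M.X, (s.card : ℝ) ≤ N ε₀ ε₁ ∧
      (∀ c ∈ s, ε₁ < Metric.infDist c M.bdry) ∧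
      ((Set.univ : Set M.X) \ M.tnb ε₀) ⊆ ⋃ c ∈ s, Metric.ball c ε₁

/-- The class `ℳ(𝔑₀,Λ₀)`. -/
def InClassML (N : ℝ → ℝ → ℝ) (Λ : ℝ) (M : RMB) : Prop :=
  InClassM N M ∧ M.RicBddBy Λ

/-- An `(ε̲,ε̄)`-connected component of `M`: a compact connected region with
boundary contained in `𝒯(∂M,ε̄) ∖ closure (𝒯(∂M,ε̲))`. -/
def IsEpsComponent (M : RMB) (e1 e2 : ℝ) (Ω : Set M.X) : Prop :=
  IsCompact Ω ∧ IsConnected Ω ∧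
    frontier Ω ⊆ M.tnb e2 \ closure (M.tnb e1)

/-- A sequence of (pseudo)metric spaces indexed by `ℕ` converges in the
Gromov–Hausdorff topology to `X`. -/
def GHConv (S : ℕ → Type*) [∀ i, PseudoMetricSpace (S i)]
    (X : Type*) [PseudoMetricSpace X] : Prop :=
  ∀ ε : ℝ, 0 < ε → ∃ N, ∀ i ≥ N, IsGHApprox (S i) X ε


/-! ### Embedded surfaces in `ℝ³` -/

/-- A smoothly embedded compact boundaryless surface in `ℝ³`, presented locally
as a regular level set of a smooth function. -/
def IsSmoothSurface (S : Set R3) : Prop :=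
  IsCompact S ∧ ∀ p ∈ S, ∃ U ∈ nhds p, ∃ f : R3 → ℝ,
    ContDiffOn ℝ (⊤ : ℕ∞) f U ∧ (∀ x ∈ U, (x ∈ S ↔ f x = 0)) ∧ ∀ x ∈ U, fderiv ℝ f x ≠ 0

/-- The union of the bounded connected components of `ℝ³ ∖ S`. -/
def boundedRegion (S : Set R3) : Set R3 :=
  {p | p ∉ S ∧ Bornology.IsBounded (connectedComponentIn Sᶜ p)}

/-- `M(S)`: the closure of the bounded component of `ℝ³ ∖ S`. -/
def MofS (S : Set R3) : Set R3 := closure (boundedRegion S)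

/-- A smoothly embedded two-sphere in `ℝ³`. -/
def IsEmbSphere (S : Set R3) : Prop :=
  IsSmoothSurface S ∧ Nonempty (↥S ≃ₜ Sphere2)

/-- A smoothly embedded two-torus in `ℝ³`. -/
def IsEmbTorus (S : Set R3) : Prop :=
  IsSmoothSurface S ∧ Nonempty (↥S ≃ₜ Torus2)

/-- `S` bounds an embedded three-ball inside `X`. -/
def BoundsBallIn (S X : Set R3) : Prop :=
  ∃ B : Set R3, B ⊆ X ∧ IsCompact B ∧ Nonempty (↥B ≃ₜ Ball3) ∧ frontier B = S

/-- `N ⊆ M` is incompressible in `M`: every loop in `N` which is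
null-homotopic in `M` is already null-homotopic in `N`
(equivalently, `π₁(N) → π₁(M)` is injective). -/
def IncompressibleIn (N M : Set R3) : Prop :=
  ∃ h : N ⊆ M, ∀ (x : ↥N) (γ : Path x x),
    Path.Homotopic (γ.map (continuous_inclusion h))
      (Path.refl (Set.inclusion h x)) →
    Path.Homotopic γ (Path.refl x)

/-- A compact region of `ℝ³` is irreducible: every smoothly embedded two-sphere
contained in it bounds an embedded three-ball in it. -/
def IrreducibleRegion (X : Set R3) : Prop :=
  ∀ S : Set R3, IsEmbSphere S → S ⊆ X → BoundsBallIn S X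



section Radial
variable {E : Type*} [NormedAddCommGroup E] [NormedSpace ℝ E]

/-- factor of the squeeze -/
def sqF (δ r : ℝ) : ℝ := (2 * δ * max r δ - δ ^ 2) / (max r δ) ^ 2
/-- factor of the inverse of the squeeze -/
def sqG (δ s : ℝ) : ℝ := δ ^ 2 / ((2 * δ - max s δ) * max s δ)

/-- radial squeeze onto the ball of radius `2δ`, identity on the ball of radius `δ`. -/
def squeeze (c : E) (δ : ℝ) (x : E) : E := c + sqF δ ‖x - c‖ • (x - c)
def unsqueeze (c : E) (δ : ℝ) (x : E) : E := c + sqG δ ‖x - c‖ • (x - c)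

lemma sqF_pos {δ r : ℝ} (hδ : 0 < δ) : 0 < sqF δ r := by
  unfold sqF
  have h : δ ≤ max r δ := le_max_right _ _
  apply div_pos
  · nlinarith
  · positivity

lemma sqG_pos {δ s : ℝ} (hδ : 0 < δ) (hs : s < 2 * δ) : 0 < sqG δ s := by
  unfold sqG
  have h : δ ≤ max s δ := le_max_right _ _
  have h2 : max s δ < 2 * δ := max_lt hs (by linarith)
  apply div_pos
  · positivity
  · apply mul_pos <;> linarith

lemma squeeze_id {c : E} {δ : ℝ} (hδ : 0 < δ) {x : E} (hx : x ∈ ball c δ) : squeeze c δ x = x := by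
  rw [mem_ball_iff_norm] at hx
  have : sqF δ ‖x - c‖ = 1 := by
    unfold sqF; rw [max_eq_right hx.le]; field_simp; ring
  simp [squeeze, this]

lemma unsqueeze_id {c : E} {δ : ℝ} (hδ : 0 < δ) {x : E} (hx : x ∈ ball c δ) :
    unsqueeze c δ x = x := by
  rw [mem_ball_iff_norm] at hx
  have : sqG δ ‖x - c‖ = 1 := by
    unfold sqG; rw [max_eq_right hx.le]; field_simp; ring
  simp [unsqueeze, this]

lemma continuous_squeeze (c : E) {δ : ℝ} (hδ : 0 < δ) : Continuous (squeeze c δ) := by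
  unfold squeeze sqF
  have : ∀ x : E, (max ‖x - c‖ δ) ^ 2 ≠ 0 := fun x => by
    have : δ ≤ max ‖x - c‖ δ := le_max_right _ _
    positivity
  fun_prop (disch := assumption)

lemma continuousAt_unsqueeze (c : E) {δ : ℝ} (hδ : 0 < δ) {x : E} (hx : x ∈ ball c (2 * δ)) :
    ContinuousAt (unsqueeze c δ) x := by
  rw [mem_ball_iff_norm] at hx
  unfold unsqueeze sqG
  have : (2 * δ - max ‖x - c‖ δ) * max ‖x - c‖ δ ≠ 0 := by
    have h : δ ≤ max ‖x - c‖ δ := le_max_right _ _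
    have h2 : max ‖x - c‖ δ < 2 * δ := max_lt hx (by linarith)
    apply mul_ne_zero <;> linarith
  fun_prop (disch := assumption)

lemma norm_squeeze_sub (c : E) {δ : ℝ} (hδ : 0 < δ) (x : E) :
    ‖squeeze c δ x - c‖ = sqF δ ‖x - c‖ * ‖x - c‖ := by
  simp [squeeze, norm_smul, abs_of_pos (sqF_pos hδ)]

lemma norm_unsqueeze_sub (c : E) {δ : ℝ} (hδ : 0 < δ) {x : E} (hx : x ∈ ball c (2 * δ)) :
    ‖unsqueeze c δ x - c‖ = sqG δ ‖x - c‖ * ‖x - c‖ := by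
  rw [mem_ball_iff_norm] at hx
  simp [unsqueeze, norm_smul, abs_of_pos (sqG_pos hδ hx)]

lemma squeeze_mem (c : E) {δ : ℝ} (hδ : 0 < δ) (x : E) : squeeze c δ x ∈ ball c (2 * δ) := by
  rw [mem_ball_iff_norm, norm_squeeze_sub c hδ]
  rcases le_or_gt ‖x - c‖ δ with h | h
  · unfold sqF; rw [max_eq_right h]
    have : (2 * δ * δ - δ ^ 2) / δ ^ 2 = 1 := by field_simp; ring
    rw [this]; linarith
  · unfold sqF; rw [max_eq_left h.le]
    have h0 : 0 < ‖x - c‖ := hδ.trans h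
    rw [div_mul_eq_mul_div, div_lt_iff₀ (by positivity)]
    nlinarith [mul_pos h0 (pow_pos hδ 2)]

lemma unsqueeze_squeeze (c : E) {δ : ℝ} (hδ : 0 < δ) (x : E) :
    unsqueeze c δ (squeeze c δ x) = x := by
  have key : sqG δ (sqF δ ‖x - c‖ * ‖x - c‖) * sqF δ ‖x - c‖ = 1 := by
    rcases le_or_gt ‖x - c‖ δ with h | h
    · have : sqF δ ‖x - c‖ = 1 := by
        unfold sqF; rw [max_eq_right h]; field_simp; ring
      rw [this, one_mul, mul_one]
      unfold sqG; rw [max_eq_right h]; field_simp; ring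
    · have h0 : 0 < ‖x - c‖ := hδ.trans h
      set r := ‖x - c‖
      have e : sqF δ r = (2 * δ * r - δ ^ 2) / r ^ 2 := by
        unfold sqF; rw [max_eq_left h.le]
      have e2 : sqF δ r * r = 2 * δ - δ ^ 2 / r := by rw [e]; field_simp
      have e3 : δ ≤ sqF δ r * r := by
        rw [e2]
        have : δ ^ 2 / r ≤ δ := by rw [div_le_iff₀ h0]; nlinarith
        linarith
      unfold sqG; rw [max_eq_left e3, e2, e]
      have : (2 * r - δ) ≠ 0 := by linarith
      field_simp
      ring_nf
      exact mul_inv_cancel₀ hδ.ne'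
  rw [unsqueeze, norm_squeeze_sub c hδ]
  simp only [squeeze, add_sub_cancel_left, smul_smul, key, one_smul]
  abel

lemma squeeze_unsqueeze (c : E) {δ : ℝ} (hδ : 0 < δ) {x : E} (hx : x ∈ ball c (2 * δ)) :
    squeeze c δ (unsqueeze c δ x) = x := by
  have hx' := hx
  rw [mem_ball_iff_norm] at hx'
  have key : sqF δ (sqG δ ‖x - c‖ * ‖x - c‖) * sqG δ ‖x - c‖ = 1 := by
    rcases le_or_gt ‖x - c‖ δ with h | h
    · have : sqG δ ‖x - c‖ = 1 := by
        unfold sqG; rw [max_eq_right h]; field_simp; ring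
      rw [this, one_mul, mul_one]
      unfold sqF; rw [max_eq_right h]; field_simp; ring
    · have h0 : 0 < ‖x - c‖ := hδ.trans h
      set r := ‖x - c‖
      have hp : 0 < 2 * δ - r := by linarith
      have e : sqG δ r = δ ^ 2 / ((2 * δ - r) * r) := by
        unfold sqG; rw [max_eq_left h.le]
      have e2 : sqG δ r * r = δ ^ 2 / (2 * δ - r) := by rw [e]; field_simp
      have e3 : δ ≤ sqG δ r * r := by
        rw [e2, le_div_iff₀ hp]; nlinarith
      unfold sqF; rw [max_eq_left e3, e2, e]
      field_simp
      ring
  rw [squeeze, norm_unsqueeze_sub c hδ hx]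
  simp only [unsqueeze, add_sub_cancel_left, smul_smul, key, one_smul]
  abel

/-- radial power map -/
def powMap (R : ℝ) (n : ℕ) (v : E) : E := (min (‖v‖ / R) 1) ^ n • v

lemma norm_powMap {R : ℝ} (hR : 0 < R) (n : ℕ) (v : E) :
    ‖powMap R n v‖ = (min (‖v‖ / R) 1) ^ n * ‖v‖ := by
  have : 0 ≤ min (‖v‖ / R) 1 := by positivity
  rw [powMap, norm_smul, Real.norm_of_nonneg (by positivity)]

lemma powMap_id {R : ℝ} (hR : 0 < R) (n : ℕ) {v : E} (hv : R ≤ ‖v‖) : powMap R n v = v := by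
  have : 1 ≤ ‖v‖ / R := by rwa [one_le_div hR]
  simp [powMap, min_eq_right this]

lemma continuous_powMap (R : ℝ) (n : ℕ) : Continuous (powMap R n : E → E) := by
  unfold powMap; fun_prop

lemma powMap_fac_mono {R : ℝ} (hR : 0 < R) (n : ℕ) :
    StrictMonoOn (fun r : ℝ => (min (r / R) 1) ^ n * r) (Ici 0) := by
  intro a ha b hb hab
  have ha' : 0 ≤ a := ha
  have hb' : 0 < b := lt_of_le_of_lt ha' hab
  have h1 : min (a / R) 1 ≤ min (b / R) 1 := by gcongr
  have h2 : 0 < min (b / R) 1 := by positivity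
  have h3 : 0 ≤ min (a / R) 1 := by positivity
  calc (min (a / R) 1) ^ n * a ≤ (min (b / R) 1) ^ n * a := by gcongr
    _ < (min (b / R) 1) ^ n * b := by gcongr

lemma powMap_injective {R : ℝ} (hR : 0 < R) (n : ℕ) : Function.Injective (powMap R n : E → E) := by
  intro v w h
  have hn : ‖v‖ = ‖w‖ := by
    have h' := congrArg norm h
    rw [norm_powMap hR, norm_powMap hR] at h'
    exact (powMap_fac_mono hR n).injOn (norm_nonneg v) (norm_nonneg w) h'
  by_cases hv : ‖v‖ = 0
  · have hw : ‖w‖ = 0 := hn ▸ hv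
    rw [norm_eq_zero.mp hv, norm_eq_zero.mp hw]
  · have : 0 < ‖v‖ := lt_of_le_of_ne (norm_nonneg _) (Ne.symm hv)
    unfold powMap at h
    rw [← hn] at h
    have hp : 0 < min (‖v‖ / R) 1 := by positivity
    exact smul_right_injective E (pow_pos hp n).ne' h

lemma powMap_surjective {R : ℝ} (hR : 0 < R) (n : ℕ) :
    Function.Surjective (powMap R n : E → E) := by
  intro w
  rcases le_or_gt R ‖w‖ with h | h
  · exact ⟨w, powMap_id hR n h⟩
  by_cases hw : w = 0
  · exact ⟨0, by simp [powMap, hw]⟩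
  have hw0 : 0 < ‖w‖ := norm_pos_iff.mpr hw
  have hc : Continuous (fun r : ℝ => (min (r / R) 1) ^ n * r) := by fun_prop
  have := intermediate_value_Icc hR.le hc.continuousOn
  have hm : ‖w‖ ∈ Icc ((min ((0:ℝ) / R) 1) ^ n * 0) ((min (R / R) 1) ^ n * R) := by
    rw [div_self hR.ne']; simp [h.le]
  obtain ⟨r, hr, hrw⟩ := this hm
  simp only at hrw
  have hr0 : 0 < r := by
    rcases hr.1.lt_or_eq with h | h
    · exact h
    · subst h; simp at hrw; exact absurd hrw.symm hw0.ne'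
  refine ⟨(r / ‖w‖) • w, ?_⟩
  have hnorm : ‖(r / ‖w‖) • w‖ = r := by
    rw [norm_smul, Real.norm_of_nonneg (by positivity)]; field_simp
  unfold powMap
  rw [hnorm, smul_smul, ← mul_div_assoc, hrw, div_self hw0.ne', one_smul]

/-- A homeomorphism of `E` supported in the ball of radius `R` shrinking a compact subset of that
ball into a small neighbourhood of `0`. -/
lemma exists_shrink [FiniteDimensional ℝ E] {R : ℝ} (hR : 0 < R) {K : Set E} {ρ : ℝ}
    (hρ : ρ < R) (hρ0 : 0 < ρ) (hK : K ⊆ closedBall 0 ρ) {N : Set E} (hN : N ∈ 𝓝 (0 : E)) :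
    ∃ z : E ≃ₜ E, (∀ v, R ≤ ‖v‖ → z v = v) ∧ ∀ v ∈ K, z v ∈ N := by
  obtain ⟨η, hη, hηN⟩ := Metric.mem_nhds_iff.mp hN
  obtain ⟨n, hn⟩ := exists_pow_lt_of_lt_one (show 0 < η / ρ by positivity)
    (show ρ / R < 1 by rwa [div_lt_one hR])
  have hcl : IsClosedMap (powMap R n : E → E) := by
    have hp : IsProperMap (powMap R n : E → E) := by
      rw [isProperMap_iff_isCompact_preimage]
      refine ⟨continuous_powMap R n, fun A hA => ?_⟩
      apply isCompact_of_isClosed_isBounded (hA.isClosed.preimage (continuous_powMap R n))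
      apply ((Metric.isBounded_closedBall (x := (0:E)) (r := R)).union hA.isBounded).subset
      intro x hx
      rcases le_or_gt R ‖x‖ with h | h
      · right
        have hx' : powMap R n x ∈ A := hx
        rwa [powMap_id hR n h] at hx'
      · left; simpa using h.le
    exact hp.isClosedMap
  have hh : IsHomeomorph (powMap R n : E → E) :=
    isHomeomorph_iff_continuous_isClosedMap_bijective.mpr
      ⟨continuous_powMap R n, hcl, powMap_injective hR n, powMap_surjective hR n⟩
  refine ⟨hh.homeomorph, fun v hv => powMap_id hR n hv, fun v hv => hηN ?_⟩
  have hv' : ‖v‖ ≤ ρ := by simpa using hK hv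
  show powMap R n v ∈ ball 0 η
  rw [mem_ball_zero_iff, norm_powMap hR]
  calc (min (‖v‖ / R) 1) ^ n * ‖v‖ ≤ (ρ / R) ^ n * ρ := by
        gcongr
        exact (min_le_left _ _).trans (by gcongr)
    _ < η / ρ * ρ := by gcongr
    _ = η := by field_simp
end Radial


open Classical in
/-- Conjugation of `k` by `f`, with `s` a partial inverse of `f`; the identity over `B`. -/
def conjLift {X Z : Type*} (f : X → Z) (k : Z → Z) (s : Z → X) (B : Set Z) (x : X) : X :=
  if f x ∈ B then x else s (k (f x))

lemma conjLift_of_mem {X Z : Type*} {f : X → Z} {k : Z → Z} {s : Z → X} {B : Set Z} {x : X}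
    (h : f x ∈ B) : conjLift f k s B x = x := by simp [conjLift, h]

lemma conjLift_eq {X Z : Type*} {f : X → Z} {k : Z → Z} {s : Z → X} {B : Set Z} {a : Z}
    (hk : ∀ z ∈ B, k z = z) (hs : ∀ y, f y ∈ B → f y ≠ a → s (f y) = y) {x : X}
    (h : f x ≠ a) : conjLift f k s B x = s (k (f x)) := by
  unfold conjLift
  split_ifs with hB
  · rw [hk _ hB, hs _ hB h]
  · rfl

lemma conjLift_continuousAt {X Z : Type*} [TopologicalSpace X] [TopologicalSpace Z] [T1Space Z]
    {f : X → Z} (hf : Continuous f) {k : Z → Z} {s : Z → X} {B : Set Z} (hB : IsOpen B) {a : Z}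
    (hk : ∀ z ∈ B, k z = z) (hs : ∀ y, f y ∈ B → f y ≠ a → s (f y) = y) {x : X}
    (hx : f x ∈ B ∨ (f x ≠ a ∧ ContinuousAt k (f x) ∧ ContinuousAt s (k (f x)))) :
    ContinuousAt (conjLift f k s B) x := by
  rcases hx with hx | ⟨hxa, hkx, hsx⟩
  · have : conjLift f k s B =ᶠ[𝓝 x] id := by
      filter_upwards [(hB.preimage hf).mem_nhds hx] with y hy
      exact conjLift_of_mem hy
    exact continuousAt_id.congr this.symm
  · have : conjLift f k s B =ᶠ[𝓝 x] s ∘ k ∘ f := by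
      filter_upwards [(isOpen_compl_singleton.preimage hf).mem_nhds hxa] with y hy
      exact conjLift_eq hk hs hy
    refine ContinuousAt.congr ?_ this.symm
    exact ContinuousAt.comp (g := s) (f := k ∘ f) hsx (hkx.comp hf.continuousAt)

lemma surjInv_continuousAt {X Z : Type*} [TopologicalSpace X] [TopologicalSpace Z]
    {f : X → Z} (hcl : IsClosedMap f) (hsurj : Function.Surjective f) {z : Z}
    (hz : ∀ x y, f x = z → f y = z → x = y) :
    ContinuousAt (Function.surjInv hsurj) z := by
  intro U hU
  obtain ⟨V, hVU, hV, hzV⟩ := mem_nhds_iff.mp hU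
  have hc : IsClosed (f '' Vᶜ) := hcl _ hV.isClosed_compl
  have hzc : z ∉ f '' Vᶜ := by
    rintro ⟨x, hx, hfx⟩
    apply hx
    rw [hz x _ hfx (Function.surjInv_eq hsurj z)]
    exact hzV
  rw [Filter.mem_map]
  filter_upwards [hc.isOpen_compl.mem_nhds hzc] with y hy
  apply hVU
  by_contra hcon
  exact hy ⟨_, hcon, Function.surjInv_eq hsurj y⟩

/-- Brown's theorem: if `f` has exactly two nondegenerate fibres then each is cellular. -/
theorem brown_two {E : Type*} [NormedAddCommGroup E] [NormedSpace ℝ E] {f : E → E}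
    (hf : Continuous f) (hcl : IsClosedMap f) (hsurj : Function.Surjective f) {a b : E}
    (hab : a ≠ b) (hinj : ∀ x y, f x = f y → f x ≠ a → f x ≠ b → x = y)
    {W : Set E} (hW : IsOpen W) (hbW : f ⁻¹' {b} ⊆ W) :
    ∃ γ : E → E, IsOpenEmbedding γ ∧ f ⁻¹' {b} ⊆ range γ ∧ range γ ⊆ W := by
  set s := Function.surjInv hsurj with hs
  have fs : ∀ z, f (s z) = z := Function.surjInv_eq hsurj
  have sf : ∀ x, f x ≠ a → f x ≠ b → s (f x) = x := fun x h1 h2 =>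
    (hinj x (s (f x)) (fs _).symm h1 h2).symm
  have scont : ∀ z, z ≠ a → z ≠ b → ContinuousAt s z := fun z h1 h2 =>
    surjInv_continuousAt hcl hsurj fun x y hx hy =>
      hinj x y (hx.trans hy.symm) (hx ▸ h1) (hx ▸ h2)
  -- first squeeze, at `a`
  obtain ⟨ε, hε, hεb⟩ : ∃ ε > 0, b ∉ ball a (2 * ε) := by
    refine ⟨dist b a / 2, by have := dist_pos.mpr hab.symm; positivity, ?_⟩
    rw [mem_ball]; linarith
  set h := squeeze a ε
  set h' := unsqueeze a ε
  have hmem : ∀ z, h z ∈ ball a (2 * ε) := squeeze_mem a hε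
  have haB : a ∈ ball a ε := mem_ball_self hε
  have hid : ∀ z ∈ ball a ε, h z = z := fun z hz => squeeze_id hε hz
  have h'id : ∀ z ∈ ball a ε, h' z = z := fun z hz => unsqueeze_id hε hz
  have h'h : ∀ z, h' (h z) = z := unsqueeze_squeeze a hε
  have hh' : ∀ z ∈ ball a (2 * ε), h (h' z) = z := fun z hz => squeeze_unsqueeze a hε hz
  have hb : ∀ z, h z ≠ b := fun z hz => hεb (hz ▸ hmem z)
  have ha : ∀ z, h z = a → z = a := fun z hz => by
    have := h'h z
    rw [hz, h'id a haB] at this; exact this.symm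
  have hbB : ∀ z ∈ ball a ε, z ≠ b := fun z hz hzb =>
    hεb (hzb ▸ ball_subset_ball (by linarith) hz)
  have sfB : ∀ y, f y ∈ ball a ε → f y ≠ a → s (f y) = y := fun y hy hya => sf y hya (hbB _ hy)
  set g := conjLift f h s (ball a ε) with hg
  have gcont : Continuous g := by
    rw [continuous_iff_continuousAt]
    intro x
    apply conjLift_continuousAt hf isOpen_ball (a := a) hid sfB
    by_cases hx : f x = a
    · left; rw [hx]; exact haB
    · right
      exact ⟨hx, (continuous_squeeze a hε).continuousAt,
        scont _ (fun h0 => hx (ha _ h0)) (hb _)⟩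
  have fg : ∀ x, f (g x) = h (f x) := by
    intro x
    by_cases hx : f x ∈ ball a ε
    · rw [hg, conjLift_of_mem hx, hid _ hx]
    · simp only [hg, conjLift, hx, if_false, fs]
  set s' := conjLift f h' s (ball a ε) with hs'
  set c := s (h b) with hc
  have fc : f c = h b := fs _
  have fca : f c ≠ a := fun h0 => hab.symm (ha b (fc ▸ h0))
  have fcb : f c ≠ b := fc ▸ hb b
  have s'cont : ∀ y, f y ∈ ball a (2 * ε) → y ≠ c → ContinuousAt s' y := by
    intro y hy hyc
    apply conjLift_continuousAt hf isOpen_ball (a := a) h'id sfB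
    by_cases hx : f y = a
    · left; rw [hx]; exact haB
    · right
      refine ⟨hx, continuousAt_unsqueeze a hε hy, scont _ ?_ ?_⟩
      · intro h0
        have := hh' _ hy
        rw [h0, hid a haB] at this
        exact hx this.symm
      · intro h0
        have := hh' _ hy
        rw [h0, ← fc] at this
        exact hyc (hinj c y this fca fcb).symm
  have s'g : ∀ x, g x ≠ c → s' (g x) = x := by
    intro x hx
    by_cases hxa : f x ∈ ball a ε
    · have : g x = x := conjLift_of_mem hxa
      rw [this]; exact conjLift_of_mem hxa
    · have hxa' : f x ≠ a := fun h0 => hxa (h0 ▸ haB)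
      have h1 : f (g x) ≠ a := by rw [fg]; exact fun h0 => hxa' (ha _ h0)
      have h2 : f x ≠ b := by
        intro h0
        apply hx
        rw [hg, conjLift, if_neg hxa, h0]
      rw [hs', conjLift_eq h'id sfB h1, fg, h'h, sf x hxa' h2]
  have gs' : ∀ y, f y ∈ ball a (2 * ε) → g (s' y) = y := by
    intro y hy
    by_cases hya : f y ∈ ball a ε
    · rw [hs', conjLift_of_mem hya]; exact conjLift_of_mem hya
    · have hya' : f y ≠ a := fun h0 => hya (h0 ▸ haB)
      have e1 : s' y = s (h' (f y)) := conjLift_eq h'id sfB hya'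
      have e2 : f (s' y) = h' (f y) := by rw [e1, fs]
      have e3 : f (g (s' y)) = f y := by rw [fg, e2, hh' _ hy]
      exact hinj _ _ e3 (e3 ▸ hya') (e3 ▸ fun h0 => hεb (h0 ▸ hy))
  have gQ : ∀ x, f x = b ↔ g x = c := by
    intro x
    constructor
    · intro hx
      have : f x ∉ ball a ε := fun h0 => hbB _ h0 hx
      rw [hg, conjLift, if_neg this, hx]
    · intro hx
      have := fg x
      rw [hx, fc] at this
      have := congrArg h' this
      rw [h'h, h'h] at this; exact this.symm
  -- the neighbourhood of `c`
  set V := (f '' Wᶜ)ᶜ with hV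
  have hVo : IsOpen V := (hcl _ hW.isClosed_compl).isOpen_compl
  have hbV : b ∈ V := by
    rintro ⟨x, hx, hfx⟩
    exact hx (hbW hfx)
  have hN : f ⁻¹' {z | z ∈ ball a (2 * ε) ∧ h' z ∈ V} ∈ 𝓝 c := by
    apply hf.continuousAt.preimage_mem_nhds
    rw [fc]
    apply Filter.inter_mem (isOpen_ball.mem_nhds (hmem b))
    refine (continuousAt_unsqueeze a hε (hmem b)).preimage_mem_nhds (t := V) ?_
    show V ∈ 𝓝 (h' (h b))
    rw [h'h]
    exact hVo.mem_nhds hbV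
  obtain ⟨δ₀, hδ₀, hδN⟩ := Metric.mem_nhds_iff.mp hN
  set δ := δ₀ / 2 with hδd
  have hδ : 0 < δ := by positivity
  have h2δ : 2 * δ = δ₀ := by rw [hδd]; ring
  rw [← h2δ] at hδN
  set k := squeeze c δ
  set k' := unsqueeze c δ
  have kmem : ∀ z, k z ∈ ball c (2 * δ) := squeeze_mem c hδ
  have hcB : c ∈ ball c δ := mem_ball_self hδ
  have kid : ∀ z ∈ ball c δ, k z = z := fun z hz => squeeze_id hδ hz
  have k'id : ∀ z ∈ ball c δ, k' z = z := fun z hz => unsqueeze_id hδ hz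
  have k'k : ∀ z, k' (k z) = z := unsqueeze_squeeze c hδ
  have kk' : ∀ z ∈ ball c (2 * δ), k (k' z) = z := fun z hz => squeeze_unsqueeze c hδ hz
  have kc : ∀ z, k z = c → z = c := fun z hz => by
    have := k'k z
    rw [hz, k'id c hcB] at this; exact this.symm
  have s'gB : ∀ y, g y ∈ ball c δ → g y ≠ c → s' (g y) = y := fun y _ hy => s'g y hy
  set γ := conjLift g k s' (ball c δ) with hγ
  set γ' := conjLift g k' s' (ball c δ) with hγ'
  have gγ : ∀ x, g (γ x) = k (g x) := by
    intro x
    by_cases hx : g x ∈ ball c δ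
    · rw [hγ, conjLift_of_mem hx, kid _ hx]
    · simp only [hγ, conjLift, hx, if_false]
      exact gs' _ (hδN (kmem _)).1
  have γcont : Continuous γ := by
    rw [continuous_iff_continuousAt]
    intro x
    apply conjLift_continuousAt gcont isOpen_ball (a := c) kid s'gB
    by_cases hx : g x = c
    · left; rw [hx]; exact hcB
    · right
      exact ⟨hx, (continuous_squeeze c hδ).continuousAt,
        s'cont _ (hδN (kmem _)).1 (fun h0 => hx (kc _ h0))⟩
  have γ'γ : ∀ x, γ' (γ x) = x := by
    intro x
    by_cases hx : g x ∈ ball c δ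
    · have : γ x = x := conjLift_of_mem hx
      rw [this]; exact conjLift_of_mem hx
    · have hxc : g x ≠ c := fun h0 => hx (h0 ▸ hcB)
      have h1 : g (γ x) ≠ c := by rw [gγ]; exact fun h0 => hxc (kc _ h0)
      rw [hγ', conjLift_eq k'id s'gB h1, gγ, k'k, s'g x hxc]
  have γγ' : ∀ y, g y ∈ ball c (2 * δ) → f (k' (g y)) ∈ ball a (2 * ε) → γ (γ' y) = y := by
    intro y hy hyV
    by_cases hya : g y ∈ ball c δ
    · rw [hγ', conjLift_of_mem hya]; exact conjLift_of_mem hya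
    · have hya' : g y ≠ c := fun h0 => hya (h0 ▸ hcB)
      have e1 : γ' y = s' (k' (g y)) := conjLift_eq k'id s'gB hya'
      have e2 : g (γ' y) = k' (g y) := by rw [e1]; exact gs' _ hyV
      have e3 : g (γ (γ' y)) = g y := by rw [gγ, e2, kk' _ hy]
      rw [← s'g (γ (γ' y)) (e3 ▸ hya'), e3, s'g y hya']
  have γ'cont : ∀ y, g y ∈ ball c (2 * δ) → f (k' (g y)) ∈ ball a (2 * ε) → ContinuousAt γ' y := by
    intro y hy hyV
    apply conjLift_continuousAt gcont isOpen_ball (a := c) k'id s'gB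
    by_cases hx : g y = c
    · left; rw [hx]; exact hcB
    · right
      refine ⟨hx, continuousAt_unsqueeze c hδ hy, s'cont _ hyV ?_⟩
      intro h0
      have := kk' _ hy
      rw [h0, kid c hcB] at this
      exact hx this.symm
  have hopen : IsOpen {y | g y ∈ ball c (2 * δ) ∧ f (k' (g y)) ∈ ball a (2 * ε)} := by
    have h1 : ContinuousOn (fun y => f (k' (g y))) (g ⁻¹' ball c (2 * δ)) := by
      intro y hy
      apply ContinuousAt.continuousWithinAt
      exact hf.continuousAt.comp
        (ContinuousAt.comp (g := k') (f := g) (continuousAt_unsqueeze c hδ hy) gcont.continuousAt)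
    exact h1.isOpen_inter_preimage (isOpen_ball.preimage gcont) isOpen_ball
  let e : OpenPartialHomeomorph E E :=
    { toFun := γ, invFun := γ', source := univ, target := {y | g y ∈ ball c (2 * δ) ∧ f (k' (g y)) ∈ ball a (2 * ε)}
      map_source' := fun x _ => by
        show g (γ x) ∈ ball c (2 * δ) ∧ f (k' (g (γ x))) ∈ ball a (2 * ε)
        rw [gγ, k'k, fg]; exact ⟨kmem _, hmem _⟩
      map_target' := fun _ _ => mem_univ _
      left_inv' := fun x _ => γ'γ x
      right_inv' := fun y hy => γγ' y hy.1 hy.2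
      open_source := isOpen_univ
      open_target := hopen
      continuousOn_toFun := γcont.continuousOn
      continuousOn_invFun := fun y hy => (γ'cont y hy.1 hy.2).continuousWithinAt }
  refine ⟨γ, e.isOpenEmbedding rfl, ?_, ?_⟩
  · intro x hx
    refine ⟨x, conjLift_of_mem ?_⟩
    rw [(gQ x).mp hx]; exact hcB
  · rintro _ ⟨x, rfl⟩
    by_contra hcon
    have h1 : k (g x) ∈ ball c (2 * δ) := kmem _
    rw [← gγ] at h1
    have h2 := (hδN h1).2
    rw [fg, h'h] at h2
    exact h2 ⟨_, hcon, rfl⟩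


section Cell
variable {E : Type*} [NormedAddCommGroup E] [NormedSpace ℝ E] [FiniteDimensional ℝ E]

/-- `X` has arbitrarily small open-cell neighbourhoods. -/
def CellularSet (X : Set E) : Prop :=
  ∀ W : Set E, IsOpen W → X ⊆ W → ∃ j : E → E, IsOpenEmbedding j ∧ X ⊆ range j ∧ range j ⊆ W

open Classical in
/-- transport of `z` by the embedding `j`, extended by the identity -/
def extMap (j : E → E) (z : E → E) (x : E) : E :=
  if h : x ∈ range j then j (z h.choose) else x

lemma extMap_apply {j : E → E} (hj : Function.Injective j) (z : E → E) (v : E) :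
    extMap j z (j v) = j (z v) := by
  have h : j v ∈ range j := ⟨v, rfl⟩
  rw [extMap, dif_pos h, hj h.choose_spec]

lemma extMap_of_notMem {j : E → E} (z : E → E) {x : E} (hx : x ∉ range j) :
    extMap j z x = x := by rw [extMap, dif_neg hx]

lemma continuous_extMap {j : E → E} (hj : IsOpenEmbedding j) {z : E → E} (hz : Continuous z)
    {R : ℝ} (hR : ∀ v, R ≤ ‖v‖ → z v = v) : Continuous (extMap j z) := by
  rw [continuous_iff_continuousAt]
  intro x
  by_cases hx : x ∈ range j
  · obtain ⟨v, rfl⟩ := hx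
    rw [← hj.continuousAt_iff]
    have : extMap j z ∘ j = j ∘ z := funext fun v => extMap_apply hj.injective z v
    rw [this]
    exact (hj.continuous.comp hz).continuousAt
  · have hc : IsClosed (j '' closedBall 0 R) :=
      ((isCompact_closedBall 0 R).image hj.continuous).isClosed
    have hxc : x ∉ j '' closedBall 0 R := fun ⟨v, _, hv⟩ => hx ⟨v, hv⟩
    have : extMap j z =ᶠ[𝓝 x] id := by
      filter_upwards [hc.isOpen_compl.mem_nhds hxc] with y hy
      by_cases hyr : y ∈ range j
      · obtain ⟨v, rfl⟩ := hyr
        rw [extMap_apply hj.injective, hR v]; · rfl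
        by_contra hcon
        exact hy ⟨v, by simpa using (not_le.mp hcon).le, rfl⟩
      · exact extMap_of_notMem z hyr
    exact continuousAt_id.congr this.symm

lemma extMap_inv {j : E → E} (hj : Function.Injective j) {z z' : E → E}
    (hz : ∀ v, z' (z v) = v) (x : E) : extMap j z' (extMap j z x) = x := by
  by_cases hx : x ∈ range j
  · obtain ⟨v, rfl⟩ := hx
    rw [extMap_apply hj, extMap_apply hj, hz]
  · rw [extMap_of_notMem z hx, extMap_of_notMem z' hx]

lemma CellularSet.shrink {X : Set E} (hX : CellularSet X) (hXc : IsCompact X) {W : Set E}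
    (hW : IsOpen W) (hXW : X ⊆ W) :
    ∃ x₀ : E, ∀ N ∈ 𝓝 x₀, ∃ θ : E ≃ₜ E, (∀ x ∉ W, θ x = x) ∧ ∀ x ∈ X, θ x ∈ N := by
  obtain ⟨j, hj, hXj, hjW⟩ := hX W hW hXW
  refine ⟨j 0, fun N hN => ?_⟩
  have hK : IsCompact (j ⁻¹' X) := hj.isInducing.isCompact_preimage' hXc hXj
  obtain ⟨ρ, hρ⟩ := hK.isBounded.subset_closedBall 0
  set ρ' := max ρ 1
  have h1 : (1:ℝ) ≤ ρ' := le_max_right _ _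
  have hρ' : j ⁻¹' X ⊆ closedBall 0 ρ' := hρ.trans (closedBall_subset_closedBall (le_max_left _ _))
  obtain ⟨z, hz, hzN⟩ := exists_shrink (E := E) (R := ρ' + 1) (by linarith) (by linarith)
    (by linarith) hρ' (hj.continuous.continuousAt.preimage_mem_nhds hN)
  have hz' : ∀ v, ρ' + 1 ≤ ‖v‖ → z.symm v = v := fun v hv => by
    rw [Homeomorph.symm_apply_eq, hz v hv]
  refine ⟨⟨⟨extMap j z, extMap j z.symm, extMap_inv hj.injective (by simp),
    extMap_inv hj.injective (by simp)⟩, continuous_extMap hj z.continuous hz,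
    continuous_extMap hj z.symm.continuous hz'⟩, ?_, ?_⟩
  · intro x hx
    exact extMap_of_notMem _ fun h => hx (hjW h)
  · intro x hx
    obtain ⟨v, rfl⟩ := hXj hx
    show extMap j z (j v) ∈ N
    rw [extMap_apply hj.injective]
    exact hzN v hx

/-- state of the construction -/
structure ShrinkState (X W₀ : Set E) where
  Θ : E ≃ₜ E
  W : Set E
  isOpen : IsOpen W
  sub : X ⊆ W
  subW : W ⊆ W₀
  fix : ∀ x ∉ W₀, Θ x = x

lemma shrink_step {X W₀ : Set E} (hX : CellularSet X) (hXc : IsCompact X)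
    (S : ShrinkState X W₀) {r : ℝ} (hr : 0 < r) :
    ∃ S' : ShrinkState X W₀, S'.W ⊆ S.W ∧ S'.W ⊆ thickening r X ∧
      (∀ x ∉ S.W, S'.Θ x = S.Θ x) ∧ (∀ x ∈ S.W, S'.Θ x ∈ S.Θ '' S.W) ∧
      ∃ z, ∀ x ∈ S'.W, S'.Θ x ∈ ball z r := by
  obtain ⟨x₀, hx₀⟩ := hX.shrink hXc S.isOpen S.sub
  obtain ⟨θ, hθ, hθX⟩ := hx₀ (S.Θ ⁻¹' ball (S.Θ x₀) r)
    (S.Θ.continuous.continuousAt.preimage_mem_nhds (ball_mem_nhds _ hr))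
  have hθW : ∀ x ∈ S.W, θ x ∈ S.W := by
    intro x hx
    by_contra hcon
    have := θ.injective (hθ _ hcon)
    rw [this] at hcon; exact hcon hx
  refine ⟨⟨θ.trans S.Θ, S.W ∩ thickening r X ∩ (θ.trans S.Θ) ⁻¹' ball (S.Θ x₀) r, ?_, ?_, ?_, ?_⟩,
    ?_, ?_, ?_, ?_, S.Θ x₀, ?_⟩
  · exact (S.isOpen.inter isOpen_thickening).inter (isOpen_ball.preimage (θ.trans S.Θ).continuous)
  · intro x hx
    exact ⟨⟨S.sub hx, self_subset_thickening hr X hx⟩, hθX x hx⟩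
  · intro x hx; exact S.subW hx.1.1
  · intro x hx
    show S.Θ (θ x) = x
    rw [hθ x (fun h => hx (S.subW h)), S.fix x hx]
  · intro x hx; exact hx.1.1
  · intro x hx; exact hx.1.2
  · intro x hx
    show S.Θ (θ x) = _
    rw [hθ x hx]
  · intro x hx
    exact ⟨θ x, hθW x hx, rfl⟩
  · intro x hx; exact hx.2

/-- A cellular set can be collapsed by a map of `E` onto itself. -/
theorem CellularSet.collapse {X W₀ : Set E} (hX : CellularSet X) (hXc : IsCompact X)
    (hXW : X ⊆ W₀) (hW : IsOpen W₀) (hWb : Bornology.IsBounded W₀) :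
    ∃ F : E → E, Continuous F ∧ (∀ x ∉ W₀, F x = x) ∧ (∀ x ∈ X, ∀ y ∈ X, F x = F y) ∧
      (∀ x y, F x = F y → x = y ∨ (x ∈ X ∧ y ∈ X)) ∧
      ∀ Y, IsCompact Y → W₀ ⊆ Y → F '' Y = Y := by
  obtain ⟨C, hC0, hC⟩ : ∃ C > 0, W₀ ⊆ ball 0 C := by
    obtain ⟨C, hC⟩ := hWb.subset_ball 0
    exact ⟨max C 1, by positivity, hC.trans (ball_subset_ball (le_max_left _ _))⟩
  let S0 : ShrinkState X W₀ := ⟨Homeomorph.refl E, W₀, hW, hXW, subset_rfl, fun _ _ => rfl⟩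
  have hr : ∀ n : ℕ, 0 < C / 2 ^ n := fun n => by positivity
  choose nxt hn1 hn2 hn3 hn4 hn5 using
    fun (S : ShrinkState X W₀) (n : ℕ) => shrink_step hX hXc S (hr n)
  let T : ℕ → ShrinkState X W₀ := fun n => Nat.rec S0 (fun n S => nxt S (n + 1)) n
  have hT : ∀ n, T (n + 1) = nxt (T n) (n + 1) := fun n => rfl
  have small : ∀ n, ∃ z, ∀ x ∈ (T n).W, (T n).Θ x ∈ ball z (C / 2 ^ n) := by
    intro n
    cases n with
    | zero => exact ⟨0, fun x hx => by
        have h : x ∈ ball (0:E) (C / 2 ^ 0) := by simpa using hC hx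
        exact h⟩
    | succ n => rw [hT]; exact hn5 _ _
  have off : ∀ n, ∀ x ∉ (T n).W, (T (n + 1)).Θ x = (T n).Θ x := fun n => by
    rw [hT]; exact hn3 _ _
  have on : ∀ n, ∀ x ∈ (T n).W, (T (n + 1)).Θ x ∈ (T n).Θ '' (T n).W := fun n => by
    rw [hT]; exact hn4 _ _
  have anti : Antitone fun n => (T n).W := antitone_nat_of_succ_le fun n => by
    rw [hT]; exact hn1 _ _
  have thick : ∀ n, (T (n + 1)).W ⊆ thickening (C / 2 ^ (n + 1)) X := fun n => by
    rw [hT]; exact hn2 _ _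
  have hdist : ∀ x n, dist ((T n).Θ x) ((T (n + 1)).Θ x) ≤ (4 * C) / 2 / 2 ^ n := by
    intro x n
    by_cases hx : x ∈ (T n).W
    · obtain ⟨z, hz⟩ := small n
      have h1 := hz x hx
      obtain ⟨y, hy, hyx⟩ := on n x hx
      have h2 := hz y hy
      rw [hyx] at h2
      have := dist_triangle_right ((T n).Θ x) ((T (n + 1)).Θ x) z
      rw [mem_ball] at h1 h2
      have e : (4 * C) / 2 / 2 ^ n = C / 2 ^ n + C / 2 ^ n := by ring
      rw [e]; linarith
    · rw [off n x hx, dist_self]; positivity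
  have hlim : ∀ x, ∃ y, Tendsto (fun n => (T n).Θ x) atTop (𝓝 y) := fun x =>
    cauchySeq_tendsto_of_complete (cauchySeq_of_le_geometric_two (hdist x))
  choose F hF using hlim
  have hFd : ∀ x n, dist ((T n).Θ x) (F x) ≤ 4 * C / 2 ^ n := fun x n =>
    dist_le_of_le_geometric_two_of_tendsto (hdist x) (hF x) n
  have hz0 : Tendsto (fun n : ℕ => 4 * C / 2 ^ n) atTop (𝓝 0) := by
    have := (tendsto_pow_atTop_nhds_zero_of_lt_one (r := (1/2:ℝ)) (by norm_num)
      (by norm_num)).const_mul (4 * C)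
    simpa [div_eq_mul_inv] using this
  have hz1 : Tendsto (fun n : ℕ => C / 2 ^ n) atTop (𝓝 0) := by
    have := hz0.const_mul (1/4)
    rw [mul_zero] at this
    refine this.congr fun n => by ring
  have hunif : TendstoUniformly (fun n x => (T n).Θ x) F atTop := by
    rw [Metric.tendstoUniformly_iff]
    intro ε hε
    filter_upwards [hz0.eventually_lt_const hε] with n hn x
    rw [dist_comm]
    exact (hFd x n).trans_lt hn
  have hFc : Continuous F := hunif.continuous (Frequently.of_forall fun n => (T n).Θ.continuous)
  have stab : ∀ n x, x ∉ (T n).W → ∀ m, n ≤ m → (T m).Θ x = (T n).Θ x := by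
    intro n x hx m hm
    induction m, hm using Nat.le_induction with
    | base => rfl
    | succ m hm ih => rw [off m x (fun h => hx (anti hm h)), ih]
  have hFstab : ∀ n x, x ∉ (T n).W → F x = (T n).Θ x := by
    intro n x hx
    apply tendsto_nhds_unique (hF x)
    apply tendsto_const_nhds.congr'
    filter_upwards [eventually_ge_atTop n] with m hm
    exact (stab n x hx m hm).symm
  have inW : ∀ n m, n ≤ m → ∀ x ∈ (T n).W, (T m).Θ x ∈ (T n).Θ '' (T n).W := by
    intro n m hm
    induction m, hm using Nat.le_induction with
    | base => intro x hx; exact ⟨x, hx, rfl⟩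
    | succ m hm ih =>
      intro x hx
      by_cases hxm : x ∈ (T m).W
      · obtain ⟨y, hy, hyx⟩ := on m x hxm
        rw [← hyx]
        exact ih y (anti hm hy)
      · rw [off m x hxm]; exact ih x hx
  have hFin : ∀ n, ∀ x ∈ X, F x ∈ (T n).Θ '' closure (T n).W := by
    intro n x hx
    rw [(T n).Θ.image_closure]
    apply mem_closure_of_tendsto (hF x)
    filter_upwards [eventually_ge_atTop n] with m hm
    exact inW n m hm x ((T n).sub hx)
  have hout : ∀ x ∉ X, ∃ n, x ∉ closure (T n).W := by
    intro x hx
    by_cases hXe : X.Nonempty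
    · have hpos : 0 < infDist x X := (hXc.isClosed.notMem_iff_infDist_pos hXe).mp hx
      have hz2 := (tendsto_add_atTop_iff_nat 1).mpr hz1
      obtain ⟨n, hn⟩ := (hz2.eventually_lt_const hpos).exists
      refine ⟨n + 1, fun hcon => ?_⟩
      have h1 := closure_mono (thick n) hcon
      have h2 := closure_thickening_subset_cthickening _ _ h1
      rw [cthickening_eq_preimage_infEDist] at h2
      have h3 : infDist x X ≤ C / 2 ^ (n + 1) := by
        rw [infDist]
        exact ENNReal.toReal_le_of_le_ofReal (hr _).le h2
      linarith
    · rw [not_nonempty_iff_eq_empty] at hXe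
      refine ⟨1, fun hcon => ?_⟩
      have h1 := closure_mono (thick 0) hcon
      simp [hXe] at h1
  refine ⟨F, hFc, ?_, ?_, ?_, ?_⟩
  · intro x hx
    exact hFstab 0 x hx
  · intro x hx y hy
    have h0 : Tendsto (fun n => dist ((T n).Θ x) ((T n).Θ y)) atTop (𝓝 0) := by
      have h2 : Tendsto (fun n : ℕ => C / 2 ^ n + C / 2 ^ n) atTop (𝓝 0) := by
        simpa using hz1.add hz1
      refine squeeze_zero (fun _ => dist_nonneg) (fun n => ?_) h2
      obtain ⟨z, hz⟩ := small n
      have h1 := mem_ball.mp (hz x ((T n).sub hx))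
      have h2 := mem_ball.mp (hz y ((T n).sub hy))
      linarith [dist_triangle_right ((T n).Θ x) ((T n).Θ y) z]
    exact dist_eq_zero.mp (tendsto_nhds_unique ((hF x).dist (hF y)) h0)
  · have key : ∀ x y, F x = F y → x ∉ X → y ∈ X → False := by
      intro x y hxy hx hy
      obtain ⟨n, hn⟩ := hout x hx
      have h1 := hFstab n x (fun h => hn (subset_closure h))
      have h2 := hFin n y hy
      rw [← hxy, h1] at h2
      obtain ⟨w, hw, hwx⟩ := h2
      exact hn ((T n).Θ.injective hwx ▸ hw)
    intro x y hxy
    by_cases hx : x ∈ X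
    · by_cases hy : y ∈ X
      · exact Or.inr ⟨hx, hy⟩
      · exact (key y x hxy.symm hy hx).elim
    · by_cases hy : y ∈ X
      · exact (key x y hxy hx hy).elim
      · left
        obtain ⟨n, hn⟩ := hout x hx
        obtain ⟨m, hm⟩ := hout y hy
        have h1 := hFstab (max n m) x
          (fun h => hn (subset_closure (anti (le_max_left n m) h)))
        have h2 := hFstab (max n m) y
          (fun h => hm (subset_closure (anti (le_max_right n m) h)))
        rw [h1, h2] at hxy
        exact (T (max n m)).Θ.injective hxy
  · intro Y hY hWY
    have hΘ : ∀ n, ∀ x, (T n).Θ x ∈ W₀ ↔ x ∈ W₀ := by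
      intro n x
      constructor
      · intro h; by_contra hc
        rw [(T n).fix x hc] at h; exact hc h
      · intro h; by_contra hc
        have := (T n).Θ.injective ((T n).fix _ hc)
        rw [this] at hc; exact hc h
    have hΘY : ∀ n, ∀ x, (T n).Θ x ∈ Y ↔ x ∈ Y := by
      intro n x
      by_cases h : x ∈ W₀
      · exact ⟨fun _ => hWY h, fun _ => hWY ((hΘ n x).mpr h)⟩
      · rw [(T n).fix x h]
    apply subset_antisymm
    · rintro _ ⟨x, hx, rfl⟩
      exact hY.isClosed.mem_of_tendsto (hF x) (Eventually.of_forall fun n => (hΘY n x).mpr hx)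
    · intro y hy
      have hcl : IsClosed (F '' Y) := (hY.image hFc).isClosed
      rw [← hcl.closure_eq, Metric.mem_closure_iff]
      intro ε hε
      obtain ⟨n, hn⟩ := (hz0.eventually_lt_const hε).exists
      refine ⟨F ((T n).Θ.symm y), ⟨_, ?_, rfl⟩, ?_⟩
      · rw [← hΘY n]; simpa using hy
      · have := hFd ((T n).Θ.symm y) n
        rw [Homeomorph.apply_symm_apply] at this
        linarith
end Cell


/-- every point complement of `Q` is an open cell modelled on `E` -/
def PointCells (Q E : Type*) [TopologicalSpace Q] [TopologicalSpace E] : Prop :=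
  ∀ q : Q, ∃ φ : OpenPartialHomeomorph Q E, φ.source = {q}ᶜ ∧ φ.target = univ

lemma pointCells_onePoint : PointCells (OnePoint R3) R3 := by
  intro q
  have h : Module.finrank ℝ R3 + 1 = Fintype.card (Fin 4) := by simp
  let e := onePointEquivSphereOfFinrankEq (ι := Fin 4) h
  haveI : Fact (Module.finrank ℝ (EuclideanSpace ℝ (Fin 4)) = 3 + 1) := ⟨by simp⟩
  refine ⟨e.toOpenPartialHomeomorph.trans (stereographic' 3 (e q)), ?_, ?_⟩
  · rw [OpenPartialHomeomorph.trans_source, stereographic'_source]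
    ext x; simp
  · rw [OpenPartialHomeomorph.trans_target, stereographic'_target]
    simp

lemma brown_two_sphere {Q E : Type*} [TopologicalSpace Q] [CompactSpace Q] [T2Space Q]
    [NormedAddCommGroup E] [NormedSpace ℝ E] (hQ : PointCells Q E) {F : Q → Q}
    (hF : Continuous F) (hsurj : Function.Surjective F) {a b : Q} (hab : a ≠ b)
    (hinj : ∀ x y, F x = F y → F x ≠ a → F x ≠ b → x = y) {q : Q} (hqa : F q ≠ a) (hqb : F q ≠ b)
    {W : Set Q} (hW : IsOpen W) (hbW : F ⁻¹' {b} ⊆ W) :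
    ∃ γ : E → Q, IsOpenEmbedding γ ∧ F ⁻¹' {b} ⊆ range γ ∧ range γ ⊆ W := by
  obtain ⟨φ, hφs, hφt⟩ := hQ q
  obtain ⟨ψ, hψs, hψt⟩ := hQ (F q)
  have hφc : IsOpenEmbedding φ.symm := φ.symm.isOpenEmbedding (by simpa using hφt)
  have hψc : IsOpenEmbedding ψ.symm := ψ.symm.isOpenEmbedding (by simpa using hψt)
  have hφq : ∀ x, φ.symm x ≠ q := fun x => by
    have := φ.map_target (x := x) (by simp [hφt]); rw [hφs] at this; exact this
  have hψq : ∀ x, ψ.symm x ≠ F q := fun x => by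
    have := ψ.map_target (x := x) (by simp [hψt]); rw [hψs] at this; exact this
  have hφl : ∀ z, z ≠ q → φ.symm (φ z) = z := fun z hz => φ.left_inv (by rw [hφs]; exact hz)
  have hψl : ∀ z, z ≠ F q → ψ.symm (ψ z) = z := fun z hz => ψ.left_inv (by rw [hψs]; exact hz)
  have hψr : ∀ z, ψ (ψ.symm z) = z := fun z => ψ.right_inv (by simp [hψt])
  have hφr : ∀ z, φ (φ.symm z) = z := fun z => φ.right_inv (by simp [hφt])
  have hne : ∀ z, z ≠ q → F z ≠ F q := fun z hz h => hz (hinj _ _ h (h ▸ hqa) (h ▸ hqb))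
  set f : E → E := fun x => ψ (F (φ.symm x)) with hf
  have hfs : ∀ x, ψ.symm (f x) = F (φ.symm x) := fun x => hψl _ (hne _ (hφq x))
  have hfc : Continuous f := by
    have h1 : ContinuousOn ψ {F q}ᶜ := hψs ▸ ψ.continuousOn
    exact h1.comp_continuous (hF.comp hφc.continuous) (fun x => hne _ (hφq x))
  have hcl : IsClosedMap f := by
    intro C hC
    have h1 : IsClosed (insert q (φ.symm '' C)) := by
      rw [← isOpen_compl_iff]
      have : (insert q (φ.symm '' C))ᶜ = φ.symm '' Cᶜ := by
        ext z
        simp only [mem_compl_iff, mem_insert_iff, mem_image, not_or, not_exists, not_and]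
        constructor
        · rintro ⟨h1, h2⟩
          exact ⟨φ z, fun h => h2 _ h (hφl z h1), hφl z h1⟩
        · rintro ⟨x, hx, rfl⟩
          exact ⟨hφq x, fun y hy h => hx (hφc.injective h ▸ hy)⟩
      rw [this]
      exact hφc.isOpenMap _ hC.isOpen_compl
    have h2 : IsClosed (F '' (insert q (φ.symm '' C))) := (h1.isCompact.image hF).isClosed
    have : f '' C = ψ.symm ⁻¹' (F '' (insert q (φ.symm '' C))) := by
      ext y
      simp only [mem_image, mem_preimage, mem_insert_iff]
      constructor
      · rintro ⟨x, hx, rfl⟩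
        exact ⟨_, Or.inr ⟨x, hx, rfl⟩, (hfs x).symm⟩
      · rintro ⟨z, rfl | ⟨x, hx, rfl⟩, hz⟩
        · exact absurd hz.symm (hψq y)
        · exact ⟨x, hx, by rw [hf]; simp only; rw [hz, hψr]⟩
    rw [this]
    exact h2.preimage hψc.continuous
  have hfsurj : Function.Surjective f := by
    intro y
    obtain ⟨z, hz⟩ := hsurj (ψ.symm y)
    have hzq : z ≠ q := by rintro rfl; exact hψq y hz.symm
    exact ⟨φ z, by simp only [hf]; rw [hφl z hzq, hz, hψr]⟩
  have hfab : ∀ x c, c ≠ F q → (f x = ψ c ↔ F (φ.symm x) = c) := by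
    intro x c hc
    constructor
    · intro h; rw [← hfs, h, hψl c hc]
    · intro h; simp only [hf]; rw [h]
  obtain ⟨γ, hγ, h1, h2⟩ := brown_two (f := f) hfc hcl hfsurj (a := ψ a) (b := ψ b)
    (fun h => hab (by rw [← hψl a hqa.symm, h, hψl b hqb.symm]))
    (by
      intro x y hxy hxa hxb
      apply hφc.injective
      apply hinj
      · rw [← hfs, hxy, hfs]
      · exact fun h => hxa ((hfab x a hqa.symm).2 h)
      · exact fun h => hxb ((hfab x b hqb.symm).2 h))
    (W := φ.symm ⁻¹' W) (hW.preimage hφc.continuous)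
    (by intro x hx; exact hbW ((hfab x b hqb.symm).1 hx))
  refine ⟨φ.symm ∘ γ, hφc.comp hγ, ?_, ?_⟩
  · intro z hz
    have hzq : z ≠ q := by rintro rfl; exact hqb hz
    have : φ z ∈ f ⁻¹' {ψ b} := (hfab _ b hqb.symm).2 (by rw [hφl z hzq]; exact hz)
    obtain ⟨w, hw⟩ := h1 this
    exact ⟨w, by simp [hw, hφl z hzq]⟩
  · rintro _ ⟨w, rfl⟩
    exact h2 ⟨w, rfl⟩


section AbsCollapse
variable {Q : Type*} [TopologicalSpace Q]

open Classical in
/-- the collapsing map determined by a partial homeomorphism -/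
def colMap (P : OpenPartialHomeomorph Q Q) (D : Set Q) (a b : Q) (z : Q) : Q :=
  if z ∈ P.source then P z else if z ∈ D then b else a

lemma colMap_cont_aux [CompactSpace Q] [T2Space Q] (P : OpenPartialHomeomorph Q Q) {D : Set Q}
    {a b : Q}
    (ht : P.target = {a, b}ᶜ) (hD : IsOpen D) {B : Set Q} (hB : IsClosed B) (haB : a ∉ B)
    (hPB : ∀ z ∈ D, z ∈ P.source → P z ∈ B) {g : Q → Q} (hgs : ∀ z ∈ P.source, g z = P z)
    (hgD : ∀ z ∈ D, z ∉ P.source → g z = b) {z : Q} (hz : z ∈ D) (hzN : z ∉ P.source) :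
    ContinuousAt g z := by
  rw [ContinuousAt, hgD z hz hzN, _root_.tendsto_nhds]
  intro O hO hbO
  have hK : IsClosed (P.symm '' (B ∩ Oᶜ)) := by
    apply IsCompact.isClosed
    apply (hB.inter hO.isClosed_compl).isCompact.image_of_continuousOn
    apply P.continuousOn_symm.mono
    rw [ht]
    rintro w ⟨hw1, hw2⟩ (rfl | rfl)
    · exact haB hw1
    · exact hw2 hbO
  have hsub : B ∩ Oᶜ ⊆ P.target := by
    rw [ht]
    rintro w ⟨hw1, hw2⟩ (rfl | rfl)
    · exact haB hw1
    · exact hw2 hbO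
  have hzK : z ∈ (P.symm '' (B ∩ Oᶜ))ᶜ := by
    rintro ⟨w, hw, rfl⟩
    exact hzN (P.map_target (hsub hw))
  filter_upwards [hD.mem_nhds hz, hK.isOpen_compl.mem_nhds hzK] with w hw1 hw2
  by_cases hwN : w ∈ P.source
  · rw [mem_preimage, hgs w hwN]
    by_contra hcon
    exact hw2 ⟨P w, ⟨hPB w hw1 hwN, hcon⟩, P.left_inv hwN⟩
  · rw [mem_preimage, hgD w hw1 hwN]; exact hbO

lemma colMap_cont [CompactSpace Q] [T2Space Q] (P : OpenPartialHomeomorph Q Q) {D D' : Set Q}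
    {a b : Q}
    (ht : P.target = {a, b}ᶜ) (hD : IsOpen D) (hD' : IsOpen D') (hdis : Disjoint D D')
    (hcov : ∀ z, z ∈ P.source ∨ z ∈ D ∨ z ∈ D')
    {B B' : Set Q} (hB : IsClosed B) (haB : a ∉ B) (hB' : IsClosed B') (haB' : b ∉ B')
    (hPB : ∀ z ∈ D, z ∈ P.source → P z ∈ B) (hPB' : ∀ z ∈ D', z ∈ P.source → P z ∈ B') :
    Continuous (colMap P D a b) := by
  have h1 : ∀ z ∈ P.source, colMap P D a b z = P z := fun z hz => by simp [colMap, hz]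
  rw [continuous_iff_continuousAt]
  intro z
  by_cases hzN : z ∈ P.source
  · apply (P.continuousAt hzN).congr
    filter_upwards [P.open_source.mem_nhds hzN] with w hw
    rw [h1 w hw]
  · rcases hcov z with h | h | h
    · exact absurd h hzN
    · exact colMap_cont_aux P ht hD hB haB hPB h1
        (fun w hw hwN => by simp [colMap, hw, hwN]) h hzN
    · exact colMap_cont_aux P (by rw [ht, Set.pair_comm]) hD' hB' haB' hPB' h1
        (fun w hw hwN => by
          have : w ∉ D := fun h => Set.disjoint_left.1 hdis h hw
          simp [colMap, this, hwN]) h hzN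

end AbsCollapse

open Classical in
/-- the collapse onto the ball -/
def ballCol (P : OpenPartialHomeomorph R3 R3) (x : R3) : R3 := if x ∈ P.source then P x else 0

lemma onePoint_colMap (P : OpenPartialHomeomorph R3 R3) (ht : P.target = {0}ᶜ) {D : Set R3}
    (hD : IsOpen D) (hDb : Bornology.IsBounded D) (hfr : frontier D ⊆ P.source)
    (hlt : ∀ x ∈ P.source, (‖P x‖ < 1 ↔ x ∈ D))
    (heq : ∀ x ∈ P.source, (‖P x‖ = 1 ↔ x ∈ frontier D)) :
    ∃ F : OnePoint R3 → OnePoint R3, Continuous F ∧ F OnePoint.infty = OnePoint.infty ∧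
      (∀ x ∈ P.source, F (x : OnePoint R3) = ((P x : R3) : OnePoint R3)) ∧
      (∀ x ∈ D, x ∉ P.source → F (x : OnePoint R3) = ((0 : R3) : OnePoint R3)) ∧
      (∀ x, x ∉ D → x ∉ P.source → F (x : OnePoint R3) = OnePoint.infty) := by
  have hoe : IsOpenEmbedding ((↑) : R3 → OnePoint R3) := OnePoint.isOpenEmbedding_coe
  let c : OpenPartialHomeomorph R3 (OnePoint R3) := hoe.toOpenPartialHomeomorph _
  have hcs : c.source = univ := rfl
  have hcc : ∀ x, c x = (x : OnePoint R3) := fun x => rfl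
  let P' : OpenPartialHomeomorph (OnePoint R3) (OnePoint R3) := (c.symm.trans P).trans c
  have hcl : ∀ x : R3, c.symm (x : OnePoint R3) = x := fun x => c.left_inv (by simp [hcs])
  have hP's : ∀ z, z ∈ P'.source ↔ ∃ x ∈ P.source, (x : OnePoint R3) = z := by
    intro z
    simp only [P', OpenPartialHomeomorph.trans_source, hcs, mem_inter_iff, mem_preimage,
      OpenPartialHomeomorph.symm_source, mem_univ, and_true]
    constructor
    · rintro ⟨h1, h2⟩
      exact ⟨_, h2, c.right_inv h1⟩
    · rintro ⟨x, hx, rfl⟩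
      refine ⟨?_, by rw [hcl]; exact hx⟩
      have : c x ∈ c.target := c.map_source (by simp [hcs])
      exact this
  have hP'c : ∀ x : R3, P' (x : OnePoint R3) = ((P x : R3) : OnePoint R3) := by
    intro x
    simp only [P', OpenPartialHomeomorph.coe_trans, Function.comp, hcl, hcc]
  have hP'sc : ∀ x : R3, (x : OnePoint R3) ∈ P'.source ↔ x ∈ P.source := by
    intro x; rw [hP's]; constructor
    · rintro ⟨y, hy, h⟩; rw [← OnePoint.coe_injective h]; exact hy
    · intro h; exact ⟨x, h, rfl⟩
  have hP't : P'.target = {OnePoint.infty, ((0 : R3) : OnePoint R3)}ᶜ := by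
    have : P'.target = P' '' P'.source := (P'.image_source_eq_target).symm
    rw [this]
    ext z
    simp only [mem_image, hP's, mem_compl_iff, mem_insert_iff, mem_singleton_iff, not_or]
    constructor
    · rintro ⟨_, ⟨x, hx, rfl⟩, rfl⟩
      rw [hP'c]
      refine ⟨OnePoint.coe_ne_infty _, fun h => ?_⟩
      have h2 := P.map_source hx
      rw [ht] at h2
      exact h2 (OnePoint.coe_injective h)
    · rintro ⟨h1, h2⟩
      obtain ⟨y, rfl⟩ := OnePoint.ne_infty_iff_exists.1 h1
      have hy : y ∈ P.target := by
        rw [ht]; rintro rfl; exact h2 rfl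
      exact ⟨_, ⟨P.symm y, P.map_target hy, rfl⟩, by rw [hP'c, P.right_inv hy]⟩
  have hYc : IsCompact (closure D) := hDb.isCompact_closure
  have hDD : D ⊆ closure D := subset_closure
  have hcomp : ∀ K : Set R3, IsCompact K → IsClosed (((↑) : R3 → OnePoint R3) '' K) :=
    fun K hK => (hK.image hoe.continuous).isClosed
  refine ⟨colMap P' ((↑) '' D) OnePoint.infty ((0 : R3) : OnePoint R3), ?_, ?_, ?_, ?_, ?_⟩
  · refine colMap_cont P' hP't (D' := (((↑) : R3 → OnePoint R3) '' closure D)ᶜ)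
      (hoe.isOpenMap _ hD) (hcomp _ hYc).isOpen_compl ?_ ?_
      (B := (↑) '' closedBall (0 : R3) 1) (B' := ((↑) '' ball (0 : R3) 1)ᶜ)
      (hcomp _ (isCompact_closedBall _ _)) ?_ (hoe.isOpenMap _ isOpen_ball).isClosed_compl ?_ ?_ ?_
    · rw [Set.disjoint_compl_right_iff_subset]
      exact image_mono hDD
    · intro z
      induction z using OnePoint.rec with
      | infty => right; right; simp
      | coe x =>
        rw [hP'sc]
        by_cases hx : x ∈ closure D
        · by_cases hxD : x ∈ D
          · right; left; exact ⟨x, hxD, rfl⟩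
          · left; apply hfr; rw [hD.frontier_eq]; exact ⟨hx, hxD⟩
        · right; right
          rintro ⟨y, hy, h⟩; rw [OnePoint.coe_injective h] at hy; exact hx hy
    · simp
    · simp
    · rintro _ ⟨x, hx, rfl⟩ hx2
      rw [hP'sc] at hx2
      rw [hP'c]
      exact ⟨_, by rw [mem_closedBall_zero_iff]; exact ((hlt x hx2).2 hx).le, rfl⟩
    · intro z hz hz2
      obtain ⟨x, hx, rfl⟩ := (hP's z).1 hz2
      rw [hP'c]
      rintro ⟨y, hy, h⟩
      rw [OnePoint.coe_injective h, mem_ball_zero_iff, hlt x hx] at hy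
      exact hz ⟨x, hDD hy, rfl⟩
  · have : (OnePoint.infty : OnePoint R3) ∉ P'.source := by rw [hP's]; simp
    simp [colMap, this]
  · intro x hx
    simp [colMap, (hP'sc x).2 hx, hP'c]
  · intro x hx hx2
    have := (hP'sc x).not.2 hx2
    simp [colMap, this, hx]
  · intro x hx hx2
    have := (hP'sc x).not.2 hx2
    simp [colMap, this, hx]

theorem schoenflies_top (P : OpenPartialHomeomorph R3 R3) (ht : P.target = {0}ᶜ) {D : Set R3}
    (hD : IsOpen D) (hDb : Bornology.IsBounded D) (hfr : frontier D ⊆ P.source)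
    (hlt : ∀ x ∈ P.source, (‖P x‖ < 1 ↔ x ∈ D))
    (heq : ∀ x ∈ P.source, (‖P x‖ = 1 ↔ x ∈ frontier D)) :
    Nonempty (↥(closure D) ≃ₜ Ball3) := by
  have hoe : IsOpenEmbedding ((↑) : R3 → OnePoint R3) := OnePoint.isOpenEmbedding_coe
  obtain ⟨G, hGc, hGi, hGN, hGD, hGo⟩ := onePoint_colMap P ht hD hDb hfr hlt heq
  have hYc : IsCompact (closure D) := hDb.isCompact_closure
  have hDD : D ⊆ closure D := subset_closure
  have hY : ∀ x ∈ closure D, x ∈ D ∨ x ∈ frontier D := fun x hx => by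
    by_cases h : x ∈ D
    · exact Or.inl h
    · right; rw [hD.frontier_eq]; exact ⟨hx, h⟩
  have hP0 : ∀ x ∈ P.source, P x ≠ 0 := fun x hx => by
    have := P.map_source hx; rw [ht] at this; exact this
  have hP0' : ∀ v : R3, v ≠ 0 → v ∈ P.target := fun v hv => by rw [ht]; exact hv
  set X := D \ P.source with hX
  have hXcl : X = closure D \ P.source := by
    ext x; constructor
    · rintro ⟨h1, h2⟩; exact ⟨hDD h1, h2⟩
    · rintro ⟨h1, h2⟩
      rcases hY x h1 with h | h
      · exact ⟨h, h2⟩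
      · exact absurd (hfr h) h2
  have hXc : IsCompact X := by rw [hXcl]; exact hYc.diff P.open_source
  have hXne : X.Nonempty := by
    by_contra hne
    have hsub : closure D ⊆ P.source := by
      intro x hx
      by_contra h
      exact hne ⟨x, by rw [hXcl]; exact ⟨hx, h⟩⟩
    have hK : IsClosed (P '' closure D) :=
      (hYc.image_of_continuousOn (P.continuousOn.mono hsub)).isClosed
    have h0 : (0 : R3) ∈ P '' closure D := by
      have h1 : (ball (0 : R3) 1 \ {0}) ⊆ P '' closure D := by
        rintro v ⟨hv, hv0⟩
        have hvt := hP0' v hv0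
        refine ⟨P.symm v, hDD ?_, P.right_inv hvt⟩
        rw [← hlt _ (P.map_target hvt), P.right_inv hvt]
        simpa using hv
      have h2 : (0 : R3) ∈ closure (ball (0 : R3) 1 \ {0}) := by
        have h3 : (0 : R3) ∈ closure ({0}ᶜ : Set R3) := by
          rw [(dense_compl_singleton (0 : R3)).closure_eq]; trivial
        have := closure_inter_open_nonempty_iff (s := ({0}ᶜ : Set R3)) (isOpen_ball (x := (0 : R3)) (ε := 1))
        rw [mem_closure_iff_nhds] at h3 ⊢
        intro t htt
        obtain ⟨y, hy1, hy2⟩ := h3 (t ∩ ball 0 1) (inter_mem htt (ball_mem_nhds _ one_pos))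
        exact ⟨y, hy1.1, hy1.2, hy2⟩
      exact hK.closure_subset_iff.2 h1 h2
    obtain ⟨x, hx, hx0⟩ := h0
    exact hP0 x (hsub hx) hx0
  have hG0 : ∀ z, G z = ((0 : R3) : OnePoint R3) ↔ ∃ x ∈ X, (x : OnePoint R3) = z := by
    intro z
    constructor
    · intro h
      induction z using OnePoint.rec with
      | infty => rw [hGi] at h; exact absurd h.symm (OnePoint.coe_ne_infty _)
      | coe x =>
        by_cases hx : x ∈ P.source
        · rw [hGN x hx] at h; exact absurd (OnePoint.coe_injective h) (hP0 x hx)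
        · by_cases hxD : x ∈ D
          · exact ⟨x, ⟨hxD, hx⟩, rfl⟩
          · rw [hGo x hxD hx] at h; exact absurd h.symm (OnePoint.coe_ne_infty _)
    · rintro ⟨x, hx, rfl⟩
      exact hGD x hx.1 hx.2
  have hGinj : ∀ z, G z ≠ OnePoint.infty → G z ≠ ((0 : R3) : OnePoint R3) →
      ∃ x ∈ P.source, (x : OnePoint R3) = z := by
    intro z h1 h2
    induction z using OnePoint.rec with
    | infty => exact absurd hGi h1
    | coe x =>
      by_cases hx : x ∈ P.source
      · exact ⟨x, hx, rfl⟩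
      · by_cases hxD : x ∈ D
        · exact absurd (hGD x hxD hx) h2
        · exact absurd (hGo x hxD hx) h1
  have hcell : CellularSet X := by
    intro W hW hXW
    obtain ⟨v, hv⟩ := exists_ne (0 : R3)
    have hvt := hP0' v hv
    obtain ⟨γ, hγ, h1, h2⟩ := brown_two_sphere pointCells_onePoint hGc
      (a := OnePoint.infty) (b := ((0 : R3) : OnePoint R3))
      (by
        intro z
        induction z using OnePoint.rec with
        | infty => exact ⟨_, hGi⟩
        | coe x =>
          by_cases hx : x = 0
          · obtain ⟨y, hy⟩ := hXne
            exact ⟨y, by rw [hGD y hy.1 hy.2, hx]⟩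
          · exact ⟨(P.symm x : R3), by
              rw [hGN _ (P.map_target (hP0' x hx)), P.right_inv (hP0' x hx)]⟩)
      (OnePoint.coe_ne_infty _).symm
      (by
        intro x y hxy hxa hxb
        obtain ⟨x, hx, rfl⟩ := hGinj x hxa hxb
        rw [hxy] at hxa hxb
        obtain ⟨y, hy, rfl⟩ := hGinj y hxa hxb
        rw [hGN x hx, hGN y hy] at hxy
        rw [P.injOn hx hy (OnePoint.coe_injective hxy)])
      (q := ((P.symm v : R3) : OnePoint R3))
      (by rw [hGN _ (P.map_target hvt)]; exact OnePoint.coe_ne_infty _)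
      (by
        rw [hGN _ (P.map_target hvt), P.right_inv hvt]
        exact fun h => hv (OnePoint.coe_injective h))
      (W := (↑) '' W) (hoe.isOpenMap _ hW)
      (by
        intro z hz
        obtain ⟨x, hx, rfl⟩ := (hG0 z).1 hz
        exact ⟨x, hXW hx, rfl⟩)
    have hex : ∀ w, ∃ x ∈ W, (x : OnePoint R3) = γ w := fun w => h2 ⟨w, rfl⟩
    choose j hjW hj using hex
    have hcomp : ((↑) : R3 → OnePoint R3) ∘ j = γ := funext hj
    refine ⟨j, ?_, ?_, ?_⟩
    · rw [← hcomp] at hγ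
      exact (IsOpenEmbedding.of_comp_iff j hoe).1 hγ
    · intro x hx
      have : (x : OnePoint R3) ∈ G ⁻¹' {((0 : R3) : OnePoint R3)} := (hG0 _).2 ⟨x, hx, rfl⟩
      obtain ⟨w, hw⟩ := h1 this
      exact ⟨w, OnePoint.coe_injective (by rw [hj, hw])⟩
    · rintro _ ⟨w, rfl⟩; exact hjW w
  obtain ⟨F, hFc, hFo, hFX, hFinj, hFY⟩ := hcell.collapse hXc (W₀ := D) sdiff_subset hD hDb
  have hFYY := hFY (closure D) hYc hDD
  -- the ball side
  have hbc : ∀ x ∈ closure D, ((ballCol P x : R3) : OnePoint R3) = G (x : OnePoint R3) := by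
    intro x hx
    by_cases hxN : x ∈ P.source
    · simp [ballCol, hxN, hGN]
    · have : x ∈ X := by rw [hXcl]; exact ⟨hx, hxN⟩
      simp [ballCol, hxN, hGD x this.1 hxN]
  let p : closure D → Ball3 := fun x => ⟨ballCol P x, by
    by_cases hxN : (x : R3) ∈ P.source
    · simp only [ballCol, hxN, if_true]
      rcases hY x x.2 with h | h
      · exact ((hlt _ hxN).2 h).le
      · exact ((heq _ hxN).2 h).le
    · simp [ballCol, hxN]⟩
  have hpc : Continuous p := by
    apply Continuous.subtype_mk
    rw [hoe.isInducing.continuous_iff]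
    have : ((↑) : R3 → OnePoint R3) ∘ (fun x : closure D => ballCol P x)
        = fun x : closure D => G ((x : R3) : OnePoint R3) := funext fun x => hbc x x.2
    rw [this]
    exact hGc.comp (hoe.continuous.comp continuous_subtype_val)
  have hps : Function.Surjective p := by
    rintro ⟨v, hv⟩
    by_cases hv0 : v = 0
    · obtain ⟨x, hx⟩ := hXne
      refine ⟨⟨x, hDD hx.1⟩, Subtype.ext ?_⟩
      simp [p, ballCol, hx.2, hv0]
    · have hvt := hP0' v hv0
      have hs := P.map_target hvt
      have hin : P.symm v ∈ closure D := by
        rcases hv.lt_or_eq with h | h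
        · exact hDD ((hlt _ hs).1 (by rwa [P.right_inv hvt]))
        · exact frontier_subset_closure ((heq _ hs).1 (by rwa [P.right_inv hvt]))
      refine ⟨⟨P.symm v, hin⟩, Subtype.ext ?_⟩
      simp [p, ballCol, hs, P.right_inv hvt]
  haveI : CompactSpace (closure D) := isCompact_iff_compactSpace.1 hYc
  have hpf : ∀ x y : closure D, p x = p y ↔ F x = F y := by
    intro x y
    have hpe : p x = p y ↔ ballCol P x = ballCol P y := Subtype.ext_iff
    rw [hpe]
    have hmem : ∀ z : closure D, (z : R3) ∈ P.source ∨ (z : R3) ∈ X := fun z => by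
      by_cases h : (z : R3) ∈ P.source
      · exact Or.inl h
      · right; rw [hXcl]; exact ⟨z.2, h⟩
    constructor
    · intro h
      rcases hmem x with hx | hx <;> rcases hmem y with hy | hy
      · simp only [ballCol, hx, hy, if_true] at h
        rw [P.injOn hx hy h]
      · simp only [ballCol, hx, hy.2, if_true, if_false] at h
        exact absurd h (hP0 _ hx)
      · simp only [ballCol, hx.2, hy, if_true, if_false] at h
        exact absurd h.symm (hP0 _ hy)
      · exact hFX _ hx _ hy
    · intro h
      rcases hFinj _ _ h with h | ⟨h1, h2⟩
      · rw [h]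
      · simp [ballCol, h1.2, h2.2]
  have hFm : ∀ x : closure D, F x ∈ closure D := fun x => by
    have := mem_image_of_mem F x.2
    rwa [hFYY] at this
  let Fr : closure D → closure D := fun x => ⟨F x, hFm x⟩
  have hFrc : Continuous Fr := (hFc.comp continuous_subtype_val).subtype_mk _
  let u : Ball3 → closure D := fun v => Fr (Function.surjInv hps v)
  have hup : u ∘ p = Fr := by
    funext x
    apply Subtype.ext
    exact (hpf _ _).1 (Function.surjInv_eq hps (p x))
  have huc : Continuous u := by
    have hq : IsQuotientMap p := hpc.isClosedMap.isQuotientMap hpc hps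
    rw [hq.continuous_iff, hup]; exact hFrc
  have hub : Function.Bijective u := by
    constructor
    · intro v w h
      have h2 : F (Function.surjInv hps v : closure D) = F (Function.surjInv hps w : closure D) :=
        congrArg Subtype.val h
      have := (hpf _ _).2 h2
      rwa [Function.surjInv_eq hps, Function.surjInv_eq hps] at this
    · rintro ⟨y, hy⟩
      rw [← hFYY] at hy
      obtain ⟨x, hx, rfl⟩ := hy
      exact ⟨p ⟨x, hx⟩, by rw [← Function.comp_apply (f := u), hup]⟩
  haveI : CompactSpace Ball3 := by
    have : IsCompact {x : R3 | ‖x‖ ≤ 1} := by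
      have := isCompact_closedBall (0 : R3) 1
      have h2 : {x : R3 | ‖x‖ ≤ 1} = closedBall 0 1 := by
        ext x; rw [mem_closedBall_zero_iff]; rfl
      rwa [h2]
    exact isCompact_iff_compactSpace.1 this
  exact ⟨(Continuous.homeoOfEquivCompactToT2 (f := Equiv.ofBijective u hub) huc).symm⟩


/-- `f` is a regular local defining function of `S` at `p` -/
def Good (S : Set R3) (f : R3 → ℝ) (p : R3) : Prop :=
  ContDiffAt ℝ 2 f p ∧ fderiv ℝ f p ≠ 0 ∧ ∀ᶠ x in 𝓝 p, (x ∈ S ↔ f x = 0)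

lemma IsSmoothSurface.exists_good {S : Set R3} (hS : IsSmoothSurface S) {p : R3} (hp : p ∈ S) :
    ∃ f, Good S f p := by
  obtain ⟨U, hU, f, hf, h1, h2⟩ := hS.2 p hp
  refine ⟨f, (hf.contDiffAt hU).of_le ?_, h2 p (mem_of_mem_nhds hU), ?_⟩
  · have : ((2 : ℕ∞) : WithTop ℕ∞) ≤ ((⊤ : ℕ∞) : WithTop ℕ∞) := WithTop.coe_le_coe.2 le_top
    exact this
  · filter_upwards [hU] with x hx using h1 x hx

lemma Good.zero {S : Set R3} {f : R3 → ℝ} {p : R3} (h : Good S f p) (hp : p ∈ S) : f p = 0 :=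
  (h.2.2.self_of_nhds).1 hp

lemma Good.fderiv_cont {S : Set R3} {f : R3 → ℝ} {p : R3} (h : Good S f p) :
    ContDiffAt ℝ 1 (fderiv ℝ f) p := h.1.fderiv_right (m := 1) (by norm_num)

lemma Good.eventually {S : Set R3} {f : R3 → ℝ} {p : R3} (h : Good S f p) :
    ∀ᶠ q in 𝓝 p, Good S f q := by
  have h1 := h.1.eventually (by simp)
  have h2 := h.fderiv_cont.continuousAt.eventually_ne h.2.1
  have h3 := h.2.2.eventually_nhds
  filter_upwards [h1, h2, h3] with q a b c using ⟨a, b, c⟩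

lemma Good.neg {S : Set R3} {f : R3 → ℝ} {p : R3} (h : Good S f p) :
    Good S (fun x => - f x) p := by
  refine ⟨h.1.neg, ?_, ?_⟩
  · rw [fderiv_fun_neg]; simpa using h.2.1
  · filter_upwards [h.2.2] with x hx; rw [hx]; simp

lemma Good.differentiable {S : Set R3} {f : R3 → ℝ} {p : R3} (h : Good S f p) :
    DifferentiableAt ℝ f p := h.1.differentiableAt (by norm_num)

/-- positivity along directions -/
lemma Good.pos_dir {S : Set R3} {f : R3 → ℝ} {p : R3} (h : Good S f p) (hp : p ∈ S) {w : R3}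
    (hw : 0 < fderiv ℝ f p w) : ∀ᶠ t in 𝓝[>] (0 : ℝ), 0 < f (p + t • w) := by
  have h1 : HasDerivAt (fun t : ℝ => f (p + t • w)) (fderiv ℝ f p w) 0 := by
    have h2 : HasFDerivAt f (fderiv ℝ f p) (p + (0 : ℝ) • w) := by
      simpa using h.differentiable.hasFDerivAt
    have h3 : HasDerivAt (fun t : ℝ => p + t • w) w 0 := by
      simpa using ((hasDerivAt_id (0 : ℝ)).smul_const w).const_add p
    exact h2.comp_hasDerivAt (0 : ℝ) h3
  have h4 := h1.tendsto_slope_zero_right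
  have h5 := h4.eventually (lt_mem_nhds hw)
  filter_upwards [h5, self_mem_nhdsWithin] with t ht ht0
  simp only [zero_add, zero_smul, add_zero, h.zero hp, sub_zero, smul_eq_mul] at ht
  have ht0' : (0 : ℝ) < t := ht0
  exact (pos_iff_pos_of_mul_pos ht).1 (inv_pos.2 ht0')

lemma good_sign_aux {S : Set R3} {f g : R3 → ℝ} {p : R3} (hf : Good S f p) (hg : Good S g p)
    (hp : p ∈ S) {w : R3} (hfw : 0 < fderiv ℝ f p w) (hgw : 0 < fderiv ℝ g p w) :
    ∀ᶠ x in 𝓝 p, 0 < f x → 0 < g x := by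
  have h1 : ∀ᶠ x in 𝓝 p, Good S f x ∧ Good S g x ∧ 0 < fderiv ℝ g x w ∧ (x ∈ S ↔ f x = 0) ∧
      (x ∈ S ↔ g x = 0) := by
    have hgc : ContinuousAt (fun x => fderiv ℝ g x w) p :=
      hg.fderiv_cont.continuousAt.clm_apply continuousAt_const
    filter_upwards [hf.eventually, hg.eventually, hgc.eventually (lt_mem_nhds hgw), hf.2.2,
      hg.2.2] with x a b c d e using ⟨a, b, c, d, e⟩
  obtain ⟨r, hr, hball⟩ := Metric.eventually_nhds_iff_ball.1 h1
  -- pick c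
  have hneg : ∀ᶠ t in 𝓝[>] (0 : ℝ), 0 < -f (p + t • (-w)) :=
    hf.neg.pos_dir hp (w := -w) (by rw [fderiv_fun_neg]; simpa using hfw)
  have hsmall : ∀ᶠ t in 𝓝[>] (0 : ℝ), t * ‖w‖ < r / 2 := by
    have : Tendsto (fun t : ℝ => t * ‖w‖) (𝓝[>] 0) (𝓝 (0 * ‖w‖)) :=
      ((continuous_id.mul continuous_const).tendsto (0 : ℝ)).mono_left nhdsWithin_le_nhds
    rw [zero_mul] at this
    exact this.eventually (gt_mem_nhds (half_pos hr))
  obtain ⟨c, ⟨hc1, hc2⟩, hc0⟩ := ((hneg.and hsmall).and self_mem_nhdsWithin).exists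
  have hc0' : (0 : ℝ) < c := hc0
  have hpc : p + c • (-w) ∈ ball p r := by
    rw [mem_ball_iff_norm]; simp [norm_smul, abs_of_pos hc0']; linarith
  have hcont : ContinuousAt (fun x => f (x + c • (-w))) p := by
    have : ContinuousAt f (p + c • (-w)) := (hball _ hpc).1.differentiable.continuousAt
    exact ContinuousAt.comp (g := f) (f := fun x => x + c • (-w)) this (by fun_prop)
  have h2 : ∀ᶠ x in 𝓝 p, f (x + c • (-w)) < 0 :=
    hcont.eventually (gt_mem_nhds (by linarith))
  filter_upwards [h2, ball_mem_nhds p (half_pos hr)] with x hx hxr hfx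
  have hin : ∀ t ∈ Icc (-c) 0, x + t • w ∈ ball p r := by
    intro t ht
    rw [mem_ball_iff_norm] at hxr ⊢
    have : ‖t • w‖ ≤ c * ‖w‖ := by
      rw [norm_smul]; gcongr; rw [Real.norm_eq_abs, abs_le]; exact ⟨ht.1, ht.2.trans hc0'.le⟩
    calc ‖x + t • w - p‖ = ‖(x - p) + t • w‖ := by congr 1; abel
      _ ≤ ‖x - p‖ + ‖t • w‖ := norm_add_le _ _
      _ < r := by linarith
  have hder : ∀ (k : R3 → ℝ), (∀ z ∈ ball p r, DifferentiableAt ℝ k z) → ∀ t ∈ Icc (-c) 0,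
      HasDerivAt (fun t : ℝ => k (x + t • w)) (fderiv ℝ k (x + t • w) w) t := by
    intro k hk t ht
    have h3 : HasDerivAt (fun t : ℝ => x + t • w) w t := by
      simpa using ((hasDerivAt_id t).smul_const w).const_add x
    exact (hk _ (hin t ht)).hasFDerivAt.comp_hasDerivAt t h3
  have hfd := hder f (fun z hz => (hball z hz).1.differentiable)
  have hgd := hder g (fun z hz => (hball z hz).2.1.differentiable)
  have hfcont : ContinuousOn (fun t : ℝ => f (x + t • w)) (Icc (-c) 0) :=
    fun t ht => (hfd t ht).continuousAt.continuousWithinAt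
  have hgcont : ContinuousOn (fun t : ℝ => g (x + t • w)) (Icc (-c) 0) :=
    fun t ht => (hgd t ht).continuousAt.continuousWithinAt
  have hivt := intermediate_value_Icc (by linarith : -c ≤ 0) hfcont
  have h0 : (0 : ℝ) ∈ Icc (f (x + (-c) • w)) (f (x + (0 : ℝ) • w)) := by
    refine ⟨?_, by simpa using hfx.le⟩
    have : x + (-c) • w = x + c • (-w) := by simp
    rw [this]; exact hx.le
  obtain ⟨t, ht, hft⟩ := hivt h0
  have ht0 : t < 0 := by
    rcases ht.2.lt_or_eq with h | h
    · exact h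
    · subst h; simp only [zero_smul, add_zero] at hft; linarith
  have hb := hball _ (hin t ht)
  have hgt : g (x + t • w) = 0 := hb.2.2.2.2.1 (hb.2.2.2.1.2 hft)
  have hmono : StrictMonoOn (fun t : ℝ => g (x + t • w)) (Icc (-c) 0) := by
    apply strictMonoOn_of_deriv_pos (convex_Icc _ _) hgcont
    intro u hu
    have hu' := interior_subset hu
    rw [(hgd u hu').deriv]
    exact (hball _ (hin u hu')).2.2.1
  have := hmono ht (right_mem_Icc.2 (by linarith)) ht0
  simp only [hgt, zero_smul, add_zero] at this
  exact this

lemma exists_common_dir {φ ψ : R3 →L[ℝ] ℝ} (hφ : φ ≠ 0) (hψ : ψ ≠ 0) :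
    ∃ w, 0 < φ w ∧ ψ w ≠ 0 := by
  have key : ∃ w, φ w ≠ 0 ∧ ψ w ≠ 0 := by
    obtain ⟨u, hu⟩ : ∃ u, φ u ≠ 0 := by
      by_contra h; push Not at h; exact hφ (by ext x; simp [h])
    obtain ⟨v, hv⟩ : ∃ u, ψ u ≠ 0 := by
      by_contra h; push Not at h; exact hψ (by ext x; simp [h])
    by_cases h1 : ψ u = 0
    · by_cases h2 : φ v = 0
      · exact ⟨u + v, by simpa [h2] using hu, by simpa [h1] using hv⟩
      · exact ⟨v, h2, hv⟩
    · exact ⟨u, hu, h1⟩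
  obtain ⟨w, h1, h2⟩ := key
  rcases lt_or_gt_of_ne h1 with h | h
  · exact ⟨-w, by simpa using h, by simpa using h2⟩
  · exact ⟨w, h, h2⟩

lemma good_sign {S : Set R3} {f g : R3 → ℝ} {p : R3} (hf : Good S f p) (hg : Good S g p)
    (hp : p ∈ S) :
    (∀ᶠ x in 𝓝 p, (0 < f x ↔ 0 < g x)) ∨ (∀ᶠ x in 𝓝 p, (0 < f x ↔ 0 < - g x)) := by
  obtain ⟨w, h1, h2⟩ := exists_common_dir hf.2.1 hg.2.1
  rcases lt_or_gt_of_ne h2 with h | h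
  · right
    have h3 : 0 < fderiv ℝ (fun x => - g x) p w := by rw [fderiv_fun_neg]; simpa using h
    filter_upwards [good_sign_aux hf hg.neg hp h1 h3, good_sign_aux hg.neg hf hp h3 h1] with x a b
      using ⟨a, b⟩
  · left
    filter_upwards [good_sign_aux hf hg hp h1 h, good_sign_aux hg hf hp h h1] with x a b
      using ⟨a, b⟩

/-- a set which locally at `p` is one side of the surface -/
def LC (S : Set R3) (A : Set R3) (p : R3) : Prop :=
  (p ∉ S → (∀ᶠ x in 𝓝 p, x ∈ A) ∨ (∀ᶠ x in 𝓝 p, x ∉ A)) ∧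
  (p ∈ S → ∃ f, Good S f p ∧ ∀ᶠ x in 𝓝 p, (x ∈ A ↔ 0 < f x))

lemma LC.congr {S A B : Set R3} {p : R3} (h : LC S A p) (hAB : ∀ᶠ x in 𝓝 p, (x ∈ A ↔ x ∈ B)) :
    LC S B p := by
  refine ⟨fun hp => ?_, fun hp => ?_⟩
  · rcases h.1 hp with h1 | h1
    · left; filter_upwards [h1, hAB] with x a b using b.1 a
    · right; filter_upwards [h1, hAB] with x a b using fun hx => a (b.2 hx)
  · obtain ⟨f, hf, h1⟩ := h.2 hp
    refine ⟨f, hf, ?_⟩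
    filter_upwards [h1, hAB] with x a b; rw [← b, a]

lemma LC.swap {S A : Set R3} (hS : IsClosed S) {p : R3} (h : LC S A p) : LC S (Aᶜ \ S) p := by
  refine ⟨fun hp => ?_, fun hp => ?_⟩
  · rcases h.1 hp with h1 | h1
    · right; filter_upwards [h1] with x a b using b.1 a
    · left; filter_upwards [h1, hS.isOpen_compl.mem_nhds hp] with x a b using ⟨a, b⟩
  · obtain ⟨f, hf, h1⟩ := h.2 hp
    refine ⟨_, hf.neg, ?_⟩
    filter_upwards [h1, hf.2.2] with x a b
    simp only [Set.mem_sdiff, mem_compl_iff, a, b]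
    constructor
    · rintro ⟨h2, h3⟩
      have : f x < 0 := lt_of_le_of_ne (not_lt.1 h2) h3
      linarith
    · intro h2; exact ⟨by linarith, by linarith⟩

lemma LC.eq_or_swap {S A B : Set R3} (hS : IsClosed S) {p : R3} (hA : LC S A p) (hB : LC S B p) :
    (∀ᶠ x in 𝓝 p, (x ∈ A ↔ x ∈ B)) ∨ (∀ᶠ x in 𝓝 p, (x ∈ A ↔ x ∈ Bᶜ \ S)) := by
  by_cases hp : p ∈ S
  · obtain ⟨f, hf, h1⟩ := hA.2 hp
    obtain ⟨g, hg, h2⟩ := hB.2 hp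
    rcases good_sign hf hg hp with h | h
    · left; filter_upwards [h1, h2, h] with x a b c; rw [a, b, c]
    · right; filter_upwards [h1, h2, h, hg.2.2] with x a b c d
      simp only [Set.mem_sdiff, mem_compl_iff, a, b, c, d]
      constructor
      · intro h2; exact ⟨by linarith, by linarith⟩
      · rintro ⟨h2, h3⟩
        have : g x < 0 := lt_of_le_of_ne (not_lt.1 h2) h3
        linarith
  · have hn := hS.isOpen_compl.mem_nhds hp
    rcases hA.1 hp with h1 | h1 <;> rcases hB.1 hp with h2 | h2
    · left; filter_upwards [h1, h2] with x a b using ⟨fun _ => b, fun _ => a⟩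
    · right; filter_upwards [h1, h2, hn] with x a b c using ⟨fun _ => ⟨b, c⟩, fun _ => a⟩
    · right; filter_upwards [h1, h2, hn] with x a b c
        using ⟨fun h => absurd h a, fun h => absurd b h.1⟩
    · left; filter_upwards [h1, h2] with x a b using ⟨fun h => absurd h a, fun h => absurd h b⟩

lemma IsSmoothSurface.interior_empty {S : Set R3} (hS : IsSmoothSurface S) : interior S = ∅ := by
  rw [eq_empty_iff_forall_notMem]
  intro p hp
  obtain ⟨f, hf⟩ := hS.exists_good (interior_subset hp)
  apply hf.2.1
  have : f =ᶠ[𝓝 p] fun _ => 0 := by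
    filter_upwards [hf.2.2, mem_interior_iff_mem_nhds.1 hp] with x a b using a.1 b
  rw [this.fderiv_eq]; simp

lemma LC.exists_local {S : Set R3} (hS : IsSmoothSurface S) (p : R3) :
    ∃ A, ∀ᶠ q in 𝓝 p, LC S A q := by
  have hcl : IsClosed S := hS.1.isClosed
  by_cases hp : p ∈ S
  · obtain ⟨f, hf⟩ := hS.exists_good hp
    refine ⟨{x | 0 < f x}, ?_⟩
    filter_upwards [hf.eventually] with q hq
    refine ⟨fun hqS => ?_, fun hqS => ⟨f, hq, Eventually.of_forall fun x => Iff.rfl⟩⟩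
    have h0 : f q ≠ 0 := fun h => hqS (hq.2.2.self_of_nhds.2 h)
    have hc := hq.differentiable.continuousAt
    rcases lt_or_gt_of_ne h0 with h | h
    · right; filter_upwards [hc.eventually (gt_mem_nhds h)] with x hx
      exact not_lt.2 hx.le
    · left; exact hc.eventually (lt_mem_nhds h)
  · refine ⟨∅, ?_⟩
    filter_upwards [hcl.isOpen_compl.mem_nhds hp] with q hq
    exact ⟨fun _ => Or.inr (by simp), fun h => absurd h hq⟩

/-- coloring of `U` -/
def IsCol (S U A : Set R3) : Prop := ∀ p ∈ U, LC S A p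

lemma IsCol.eq_or_swap {S U A B : Set R3} (hS : IsSmoothSurface S) (hU : IsOpen U)
    (hc : IsPreconnected U) (hA : IsCol S U A) (hB : IsCol S U B) :
    (∀ x ∈ U, (x ∈ A ↔ x ∈ B)) ∨ (∀ x ∈ U, (x ∈ A ↔ x ∈ Bᶜ \ S)) := by
  have hcl : IsClosed S := hS.1.isClosed
  set U1 : Set R3 := {p | ∀ᶠ x in 𝓝 p, (x ∈ A ↔ x ∈ B)} with hU1
  set U2 : Set R3 := {p | ∀ᶠ x in 𝓝 p, (x ∈ A ↔ x ∈ Bᶜ \ S)} with hU2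
  have ho1 : IsOpen U1 := isOpen_setOfPred_eventually_nhds
  have ho2 : IsOpen U2 := isOpen_setOfPred_eventually_nhds
  have hd : Disjoint U1 U2 := by
    rw [Set.disjoint_left]
    intro p h1 h2
    have h3 : ∀ᶠ x in 𝓝 p, x ∈ S := by
      filter_upwards [h1, h2] with x a b
      by_contra hx
      simp only [Set.mem_sdiff, mem_compl_iff, hx, not_false_eq_true, and_true] at b
      rw [a] at b
      tauto
    have : p ∈ interior S := mem_interior_iff_mem_nhds.2 h3
    rw [hS.interior_empty] at this
    exact this
  have hcov : U ⊆ U1 ∪ U2 := fun p hp => (hA p hp).eq_or_swap hcl (hB p hp)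
  rcases hc.subset_or_subset ho1 ho2 hd hcov with h | h
  · left; exact fun x hx => (h hx).self_of_nhds
  · right; exact fun x hx => (h hx).self_of_nhds

lemma IsCol.glue {S U V A B : Set R3} (hS : IsSmoothSurface S) (hU : IsOpen U) (hV : IsOpen V)
    (hc : IsPreconnected (U ∩ V)) (hA : IsCol S U A) (hB : IsCol S V B) :
    ∃ C, IsCol S (U ∪ V) C := by
  have hcl : IsClosed S := hS.1.isClosed
  have main : ∀ B, IsCol S V B → (∀ x ∈ U ∩ V, (x ∈ A ↔ x ∈ B)) → ∃ C, IsCol S (U ∪ V) C := by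
    intro B hB h
    refine ⟨(A ∩ U) ∪ (B ∩ V), ?_⟩
    rintro p (hp | hp)
    · apply (hA p hp).congr
      filter_upwards [hU.mem_nhds hp] with x hx
      constructor
      · exact fun h => Or.inl ⟨h, hx⟩
      · rintro (h1 | h1)
        · exact h1.1
        · exact (h x ⟨hx, h1.2⟩).2 h1.1
    · apply (hB p hp).congr
      filter_upwards [hV.mem_nhds hp] with x hx
      constructor
      · exact fun h => Or.inr ⟨h, hx⟩
      · rintro (h1 | h1)
        · exact (h x ⟨h1.2, hx⟩).1 h1.1
        · exact h1.1
  rcases IsCol.eq_or_swap hS (hU.inter hV) hc (fun p hp => hA p hp.1) (fun p hp => hB p hp.2)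
    with h | h
  · exact main B hB h
  · exact main _ (fun p hp => (hB p hp).swap hcl) h


lemma interval_induction {p : ℝ → ℝ → Prop} (hloc : ∀ s, ∃ δ > 0, p (s - δ) (s + δ))
    (hmono : ∀ a b a' b', a ≤ a' → b' ≤ b → a' ≤ b' → p a b → p a' b')
    (hglue : ∀ a m b, a ≤ m → m ≤ b → p a m → p m b → p a b) {a b : ℝ} (hab : a ≤ b) : p a b := by
  set T : Set ℝ := {x | a ≤ x ∧ x ≤ b ∧ p a x} with hT
  have haT : a ∈ T := by
    obtain ⟨δ, hδ, h⟩ := hloc a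
    exact ⟨le_rfl, hab, hmono _ _ _ _ (by linarith) (by linarith) le_rfl h⟩
  have hbdd : BddAbove T := ⟨b, fun x hx => hx.2.1⟩
  set c := sSup T with hc
  have hac : a ≤ c := le_csSup hbdd haT
  have hcb : c ≤ b := csSup_le ⟨a, haT⟩ fun x hx => hx.2.1
  obtain ⟨δ, hδ, h⟩ := hloc c
  obtain ⟨x, hx, hxc⟩ := exists_lt_of_lt_csSup ⟨a, haT⟩ (show c - δ < sSup T by linarith)
  have hxle : x ≤ c := le_csSup hbdd hx
  have hmin : min b (c + δ) ∈ T := by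
    have h1 : x ≤ min b (c + δ) := le_min hx.2.1 (by linarith)
    refine ⟨hx.1.trans h1, min_le_left _ _, ?_⟩
    apply hglue a x _ hx.1 h1 hx.2.2
    exact hmono _ _ _ _ hxc.le (min_le_right _ _) h1 h
  have h2 := le_csSup hbdd hmin
  rcases le_total b (c + δ) with h3 | h3
  · rw [min_eq_left h3] at hmin; exact hmin.2.2
  · rw [min_eq_right h3] at h2; linarith

/-- thickened open box -/
def tbox (a b : Fin 3 → ℝ) (ε : ℝ) : Set R3 := {x | ∀ i, x i ∈ Ioo (a i - ε) (b i + ε)}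

lemma mem_tbox {a b : Fin 3 → ℝ} {ε : ℝ} {x : R3} :
    x ∈ tbox a b ε ↔ ∀ i, a i - ε < x i ∧ x i < b i + ε := Iff.rfl

lemma tbox_convex (a b : Fin 3 → ℝ) (ε : ℝ) : Convex ℝ (tbox a b ε) :=
  fun _ hx _ hy _ _ hα hβ h i => (convex_Ioo _ _) (hx i) (hy i) hα hβ h

lemma tbox_open (a b : Fin 3 → ℝ) (ε : ℝ) : IsOpen (tbox a b ε) := by
  have : tbox a b ε = ⋂ i, (fun x : R3 => x i) ⁻¹' Ioo (a i - ε) (b i + ε) := by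
    ext x; simp only [mem_iInter]; rfl
  rw [this]
  exact isOpen_iInter_of_finite fun i => isOpen_Ioo.preimage (by fun_prop)

/-- some thickening has a coloring -/
def BoxCol (S : Set R3) (a b : Fin 3 → ℝ) : Prop := ∃ ε > 0, ∃ A, IsCol S (tbox a b ε) A

lemma BoxCol.local {S : Set R3} (hS : IsSmoothSurface S) (a : Fin 3 → ℝ) : BoxCol S a a := by
  obtain ⟨A, hA⟩ := LC.exists_local hS (WithLp.toLp 2 a)
  have hc : ContinuousAt (fun y : Fin 3 → ℝ => (WithLp.toLp 2 y : R3)) a :=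
    (PiLp.continuous_toLp 2 _).continuousAt
  obtain ⟨ε, hε, h⟩ := Metric.eventually_nhds_iff.1 (hc.eventually hA)
  refine ⟨ε, hε, A, fun x hx => ?_⟩
  have := @h (WithLp.ofLp x) (by
    rw [dist_pi_lt_iff hε]
    intro i
    rw [Real.dist_eq, abs_lt]
    have := hx i
    constructor <;> linarith [this.1, this.2])
  simpa using this

lemma BoxCol.glue {S : Set R3} (hS : IsSmoothSurface S) {a b : Fin 3 → ℝ} {i : Fin 3} {m : ℝ}
    (h1 : BoxCol S a (Function.update b i m)) (h2 : BoxCol S (Function.update a i m) b) :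
    BoxCol S a b := by
  obtain ⟨ε₁, hε₁, A, hA⟩ := h1
  obtain ⟨ε₂, hε₂, B, hB⟩ := h2
  set ε := min ε₁ ε₂ with hε
  have hε0 : 0 < ε := lt_min hε₁ hε₂
  have hm : ∀ {a b : Fin 3 → ℝ} {δ : ℝ}, ε ≤ δ → tbox a b ε ⊆ tbox a b δ := by
    intro a b δ hδ x hx j
    exact ⟨by linarith [(hx j).1], by linarith [(hx j).2]⟩
  obtain ⟨C, hC⟩ := IsCol.glue hS (tbox_open a (Function.update b i m) ε)
    (tbox_open (Function.update a i m) b ε)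
    ((tbox_convex _ _ _).inter (tbox_convex _ _ _)).isPreconnected
    (fun p hp => hA p (hm (min_le_left _ _) hp)) (fun p hp => hB p (hm (min_le_right _ _) hp))
  refine ⟨ε, hε0, C, fun p hp => hC p ?_⟩
  by_cases h : p i < m + ε
  · left
    intro j
    by_cases hj : j = i
    · subst hj; simpa using ⟨by linarith [(hp j).1], h⟩
    · simpa [hj] using hp j
  · right
    intro j
    by_cases hj : j = i
    · subst hj; simpa using ⟨by linarith [(hp j).1], (hp j).2⟩
    · simpa [hj] using hp j

lemma BoxCol.extend {S : Set R3} (hS : IsSmoothSurface S) {a b : Fin 3 → ℝ} {i : Fin 3}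
    (h : ∀ s, BoxCol S (Function.update a i s) (Function.update b i s)) {s t : ℝ} (hst : s ≤ t) :
    BoxCol S (Function.update a i s) (Function.update b i t) := by
  refine interval_induction (p := fun s t => BoxCol S (Function.update a i s)
    (Function.update b i t)) ?_ ?_ ?_ hst
  · intro s
    obtain ⟨ε, hε, A, hA⟩ := h s
    refine ⟨ε / 2, half_pos hε, ε / 2, half_pos hε, A, fun p hp => hA p fun j => ?_⟩
    have := hp j
    by_cases hj : j = i
    · subst hj
      simp only [Function.update_self, mem_Ioo] at this ⊢
      exact ⟨by linarith, by linarith⟩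
    · simp only [ne_eq, hj, not_false_eq_true, Function.update_of_ne, mem_Ioo] at this ⊢
      exact ⟨by linarith, by linarith⟩
  · intro s t s' t' h1 h2 _ h3
    obtain ⟨ε, hε, A, hA⟩ := h3
    refine ⟨ε, hε, A, fun p hp => hA p fun j => ?_⟩
    have := hp j
    by_cases hj : j = i
    · subst hj
      simp only [Function.update_self, mem_Ioo] at this ⊢
      exact ⟨by linarith, by linarith⟩
    · simpa [hj] using this
  · intro s m t _ _ h1 h2
    apply BoxCol.glue hS (i := i) (m := m)
    · simpa using h1
    · simpa using h2

lemma BoxCol.all {S : Set R3} (hS : IsSmoothSurface S) (a b : Fin 3 → ℝ) (hab : a ≤ b) :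
    BoxCol S a b := by
  have key : ∀ T : Finset (Fin 3), ∀ a b : Fin 3 → ℝ, a ≤ b → (∀ i ∉ T, a i = b i) →
      BoxCol S a b := by
    intro T
    induction T using Finset.induction_on with
    | empty =>
      intro a b _ h
      have : a = b := funext fun i => h i (by simp)
      subst this
      exact BoxCol.local hS a
    | insert i T hi ih =>
      intro a b hab h
      have := BoxCol.extend hS (a := a) (b := b) (i := i) (fun s => by
        apply ih
        · intro j
          by_cases hj : j = i
          · subst hj; simp
          · simpa [hj] using hab j
        · intro j hj
          by_cases hji : j = i
          · subst hji; simp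
          · simpa [hji] using h j (by simp [hji, hj])) (hab i)
      simpa using this
  exact key Finset.univ a b hab (by simp)

lemma norm_preconnected {I : Set ℝ} (hI : IsPreconnected I) (hpos : ∀ r ∈ I, 0 < r) :
    IsPreconnected {x : R3 | ‖x‖ ∈ I} := by
  have hs : IsPreconnected (sphere (0 : R3) 1) := by
    apply (isConnected_sphere ?_ 0 zero_le_one).isPreconnected
    rw [← Module.finrank_eq_rank]
    simp
  have : {x : R3 | ‖x‖ ∈ I} = (fun z : ℝ × R3 => z.1 • z.2) '' (I ×ˢ sphere (0 : R3) 1) := by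
    ext x
    simp only [mem_image, mem_prod, Prod.exists, mem_sphere_zero_iff_norm]
    constructor
    · intro hx
      have h0 : ‖x‖ ≠ 0 := (hpos _ hx).ne'
      exact ⟨‖x‖, ‖x‖⁻¹ • x, ⟨hx, by rw [norm_smul]; simp [h0]⟩, by rw [smul_smul]; simp [h0]⟩
    · rintro ⟨r, v, ⟨hr, hv⟩, rfl⟩
      change ‖r • v‖ ∈ I
      rw [norm_smul, hv, Real.norm_eq_abs, abs_of_pos (hpos r hr), mul_one]
      exact hr
  rw [this]
  exact (hI.prod hs).image _ (by fun_prop)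

theorem exists_side {S : Set R3} (hS : IsSmoothSurface S) :
    ∃ D : Set R3, Bornology.IsBounded D ∧ ∀ p, LC S D p := by
  have hcl : IsClosed S := hS.1.isClosed
  obtain ⟨R, hR, hSR⟩ : ∃ R > 0, S ⊆ closedBall (0 : R3) R := by
    obtain ⟨R, h⟩ := hS.1.isBounded.subset_closedBall (0 : R3)
    exact ⟨max R 1, by positivity, h.trans (closedBall_subset_closedBall (le_max_left _ _))⟩
  obtain ⟨ε, hε, A, hA⟩ := BoxCol.all hS (fun _ => -(R + 1)) (fun _ => R + 1)
    (fun _ => by linarith)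
  have hA' : IsCol S (ball 0 (R + 1)) A := by
    intro p hp
    apply hA
    intro i
    have h1 : ‖p i‖ ≤ ‖p‖ := PiLp.norm_apply_le p i
    rw [mem_ball_zero_iff] at hp
    rw [Real.norm_eq_abs, abs_le] at h1
    exact ⟨by linarith [h1.1], by linarith [h1.2]⟩
  set V : Set R3 := {x | ‖x‖ ∈ Ioi R} with hV
  have hVo : IsOpen V := isOpen_Ioi.preimage continuous_norm
  have hVS : ∀ x ∈ V, x ∉ S := fun x hx hxS => by
    have := hSR hxS
    rw [mem_closedBall_zero_iff] at this
    exact absurd this (not_le.2 hx)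
  have hVc : IsPreconnected V := norm_preconnected isPreconnected_Ioi fun r hr => hR.trans hr
  have hE : IsCol S V ∅ := fun p hp => ⟨fun _ => Or.inr (by simp), fun h => absurd h (hVS p hp)⟩
  have hann : IsPreconnected (ball (0 : R3) (R + 1) ∩ V) := by
    have : ball (0 : R3) (R + 1) ∩ V = {x : R3 | ‖x‖ ∈ Ioo R (R + 1)} := by
      ext x
      rw [mem_inter_iff, mem_ball_zero_iff]
      exact and_comm
    rw [this]
    exact norm_preconnected isPreconnected_Ioo fun r hr => hR.trans hr.1
  obtain ⟨C, hC⟩ := IsCol.glue hS isOpen_ball hVo hann hA' hE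
  have hC' : ∀ p, LC S C p := fun p => hC p (by
    by_cases h : ‖p‖ < R + 1
    · left; simpa using h
    · right; exact (by linarith : R < ‖p‖))
  have hbd : ∀ D : Set R3, (∀ x ∈ V, x ∉ D) → Bornology.IsBounded D := by
    intro D hD
    apply (isBounded_closedBall (x := (0 : R3)) (r := R)).subset
    intro x hx
    rw [mem_closedBall_zero_iff]
    by_contra h
    exact hD x (not_le.1 h) hx
  rcases IsCol.eq_or_swap hS hVo hVc (fun p _ => hC' p) hE with h | h
  · exact ⟨C, hbd C fun x hx hxC => by simpa using (h x hx).1 hxC, hC'⟩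
  · refine ⟨Cᶜ \ S, hbd _ fun x hx hxC => hxC.1 ((h x hx).2 ?_), fun p => (hC' p).swap hcl⟩
    exact ⟨by simp, hVS x hx⟩


section Side
variable {S D : Set R3}

lemma side_notMem (hD : ∀ p, LC S D p) {p : R3} (hp : p ∈ S) : p ∉ D := by
  obtain ⟨f, hf, h⟩ := (hD p).2 hp
  intro h2
  have := h.self_of_nhds.1 h2
  rw [hf.zero hp] at this
  exact lt_irrefl _ this

lemma side_open (hD : ∀ p, LC S D p) : IsOpen D := by
  rw [isOpen_iff_mem_nhds]
  intro p hp
  have hpS : p ∉ S := fun h => side_notMem hD h hp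
  rcases (hD p).1 hpS with h | h
  · exact h
  · exact absurd hp h.self_of_nhds

lemma side_ext_open (hS : IsClosed S) (hD : ∀ p, LC S D p) : IsOpen (D ∪ S)ᶜ := by
  rw [isOpen_iff_mem_nhds]
  intro p hp
  have hpS : p ∉ S := fun h => hp (Or.inr h)
  rcases (hD p).1 hpS with h | h
  · exact absurd (Or.inl h.self_of_nhds) hp
  · filter_upwards [h, hS.isOpen_compl.mem_nhds hpS] with x a b
    rintro (h | h)
    exacts [a h, b h]

lemma side_connected (hS : IsClosed S) (hD : ∀ p, LC S D p) {C : Set R3} (hC : IsPreconnected C)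
    (hCS : ∀ x ∈ C, x ∉ S) : C ⊆ D ∨ ∀ x ∈ C, x ∉ D := by
  have hdis : Disjoint D (D ∪ S)ᶜ := by
    rw [Set.disjoint_compl_right_iff_subset]; exact subset_union_left
  rcases hC.subset_or_subset (side_open hD) (side_ext_open hS hD) hdis (fun x hx => by
    by_cases h : x ∈ D
    · exact Or.inl h
    · right; rintro (h' | h')
      exacts [h h', hCS x hx h']) with h | h
  · exact Or.inl h
  · exact Or.inr fun x hx hxD => h hx (Or.inl hxD)

/-- `n` is the normal at `s` pointing into `D` -/
def IsNormal (D : Set R3) (s n : R3) : Prop :=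
  ‖n‖ = 1 ∧ (∀ w, 0 < inner ℝ n w → ∀ᶠ t in 𝓝[>] (0 : ℝ), s + t • w ∈ D) ∧
    (∀ w, inner ℝ n w < 0 → ∀ᶠ t in 𝓝[>] (0 : ℝ), s + t • w ∉ D)

lemma unit_eq_of_half {a b : R3} (ha : ‖a‖ = 1) (hb : ‖b‖ = 1)
    (h : ∀ w, 0 < inner ℝ a w → 0 ≤ inner ℝ b w) : a = b := by
  by_contra hne
  have h1 : inner ℝ a b < 1 := by
    have := inner_lt_one_iff_real_of_norm_eq_one ha hb
    exact this.2 hne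
  have h2 := h (a - b) (by
    rw [inner_sub_right, real_inner_self_eq_norm_sq, ha]; linarith)
  rw [inner_sub_right, real_inner_self_eq_norm_sq, hb, real_inner_comm] at h2
  linarith

lemma IsNormal.eq_of_half {s n a : R3} (hn : IsNormal D s n) (ha : ‖a‖ = 1)
    (h : ∀ w, 0 < inner ℝ a w → ∀ᶠ t in 𝓝[>] (0 : ℝ), s + t • w ∈ D) : a = n := by
  apply unit_eq_of_half ha hn.1
  intro w hw
  by_contra hcon
  have h1 := hn.2.2 w (not_le.1 hcon)
  obtain ⟨t, h2, h3⟩ := ((h w hw).and h1).exists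
  exact h3 h2

lemma IsNormal.eq_neg_of_half {s n a : R3} (hn : IsNormal D s n) (ha : ‖a‖ = 1)
    (h : ∀ w, 0 < inner ℝ a w → ∀ᶠ t in 𝓝[>] (0 : ℝ), s + t • w ∉ D) : a = -n := by
  apply unit_eq_of_half ha (by rw [norm_neg, hn.1])
  intro w hw
  by_contra hcon
  have h1 := hn.2.1 w (by rw [inner_neg_left] at hcon; linarith)
  obtain ⟨t, h2, h3⟩ := ((h w hw).and h1).exists
  exact h2 h3

lemma IsNormal.unique {s n m : R3} (hn : IsNormal D s n) (hm : IsNormal D s m) : n = m :=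
  hm.eq_of_half hn.1 hn.2.1

/-- oriented defining function -/
def Ori (S D : Set R3) (f : R3 → ℝ) (s : R3) : Prop :=
  Good S f s ∧ ∀ᶠ x in 𝓝 s, (x ∈ D ↔ 0 < f x)

lemma Ori.eventually {f : R3 → ℝ} {s : R3} (h : Ori S D f s) : ∀ᶠ x in 𝓝 s, Ori S D f x := by
  filter_upwards [h.1.eventually, h.2.eventually_nhds] with x a b using ⟨a, b⟩

/-- unit gradient -/
def unitN (f : R3 → ℝ) (s : R3) : R3 :=
  ‖fderiv ℝ f s‖⁻¹ • (InnerProductSpace.toDual ℝ R3).symm (fderiv ℝ f s)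

lemma inner_unitN (f : R3 → ℝ) (s w : R3) :
    inner ℝ (unitN f s) w = ‖fderiv ℝ f s‖⁻¹ * fderiv ℝ f s w := by
  rw [unitN, real_inner_smul_left, InnerProductSpace.toDual_symm_apply]

lemma Ori.isNormal {f : R3 → ℝ} {s : R3} (h : Ori S D f s) (hs : s ∈ S) :
    IsNormal D s (unitN f s) := by
  have hpos : 0 < ‖fderiv ℝ f s‖ := norm_pos_iff.2 h.1.2.1
  have hlim : ∀ w : R3, Tendsto (fun t : ℝ => s + t • w) (𝓝[>] 0) (𝓝 s) := by
    intro w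
    have h1 : Continuous (fun t : ℝ => s + t • w) := by fun_prop
    have := (h1.tendsto 0).mono_left (nhdsWithin_le_nhds (s := Ioi 0))
    simpa using this
  refine ⟨?_, ?_, ?_⟩
  · rw [unitN, norm_smul, LinearIsometryEquiv.norm_map, norm_inv, norm_norm,
      inv_mul_cancel₀ hpos.ne']
  · intro w hw
    rw [inner_unitN] at hw
    have hw' := (pos_iff_pos_of_mul_pos hw).1 (inv_pos.2 hpos)
    filter_upwards [h.1.pos_dir hs hw', (hlim w).eventually h.2] with t a b using b.2 a
  · intro w hw
    rw [inner_unitN] at hw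
    have hw' : fderiv ℝ f s w < 0 := by
      by_contra hc
      have := mul_nonneg (inv_pos.2 hpos).le (not_lt.1 hc)
      linarith
    have h3 := h.1.neg.pos_dir hs (w := w) (by rw [fderiv_fun_neg]; simpa using hw')
    filter_upwards [h3, (hlim w).eventually h.2] with t a b
    rw [b]; linarith

open Classical in
/-- the unit normal field -/
def nu (D : Set R3) (s : R3) : R3 := if h : ∃ n, IsNormal D s n then h.choose else 0

lemma nu_spec (hD : ∀ p, LC S D p) {s : R3} (hs : s ∈ S) : IsNormal D s (nu D s) := by
  obtain ⟨f, hf, h⟩ := (hD s).2 hs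
  have hex : ∃ n, IsNormal D s n := ⟨_, Ori.isNormal ⟨hf, h⟩ hs⟩
  rw [nu, dif_pos hex]; exact hex.choose_spec

lemma nu_eq (hD : ∀ p, LC S D p) {s : R3} (hs : s ∈ S) {f : R3 → ℝ} (hf : Ori S D f s) :
    nu D s = unitN f s := (nu_spec hD hs).unique (hf.isNormal hs)

lemma nu_cont (hD : ∀ p, LC S D p) : ContinuousOn (nu D) S := by
  intro s hs
  obtain ⟨f, hf, h⟩ := (hD s).2 hs
  have ho : Ori S D f s := ⟨hf, h⟩
  have hc : ContinuousAt (unitN f) s := by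
    have h1 : ContinuousAt (fderiv ℝ f) s := hf.fderiv_cont.continuousAt
    have h2 : ContinuousAt (fun s => ‖fderiv ℝ f s‖⁻¹) s :=
      h1.norm.inv₀ (norm_ne_zero_iff.2 hf.2.1)
    have h3 : ContinuousAt (fun s => (InnerProductSpace.toDual ℝ R3).symm (fderiv ℝ f s)) s :=
      (LinearIsometryEquiv.continuous _).continuousAt.comp h1
    exact h2.smul h3
  apply hc.continuousWithinAt.congr_of_eventuallyEq
  · filter_upwards [nhdsWithin_le_nhds ho.eventually, self_mem_nhdsWithin] with x a b
      using nu_eq hD b a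
  · exact nu_eq hD hs ho

lemma quad_local (hD : ∀ p, LC S D p) {p : R3} (hp : p ∈ S) :
    ∃ C : ℝ, ∀ᶠ z in 𝓝 (p, p), ∀ s s' : R3, z = (s, s') → s ∈ S → s' ∈ S →
      |inner ℝ (nu D s) (s' - s)| ≤ C * ‖s' - s‖ ^ 2 := by
  obtain ⟨f, hf, h⟩ := (hD p).2 hp
  have ho : Ori S D f p := ⟨hf, h⟩
  obtain ⟨K, t, ht, hK⟩ := hf.fderiv_cont.exists_lipschitzOnWith
  have hpos : 0 < ‖fderiv ℝ f p‖ := norm_pos_iff.2 hf.2.1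
  have hlow : ∀ᶠ x in 𝓝 p, ‖fderiv ℝ f p‖ / 2 < ‖fderiv ℝ f x‖ :=
    hf.fderiv_cont.continuousAt.norm.eventually (lt_mem_nhds (by linarith))
  obtain ⟨r, hr, hball⟩ := Metric.eventually_nhds_iff_ball.1
    ((ho.eventually.and hlow).and ht)
  refine ⟨(‖fderiv ℝ f p‖ / 2)⁻¹ * K, ?_⟩
  filter_upwards [prod_mem_nhds (ball_mem_nhds p hr) (ball_mem_nhds p hr)] with z hz
  rintro s s' rfl hs hs'
  have hsb : s ∈ ball p r := hz.1
  have hs'b : s' ∈ ball p r := hz.2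
  have hseg : segment ℝ s s' ⊆ ball p r := (convex_ball p r).segment_subset hsb hs'b
  have hest := Convex.norm_image_sub_le_of_norm_fderiv_le' (f := f) (s := segment ℝ s s') (𝕜 := ℝ)
    (φ := fderiv ℝ f s) (C := K * ‖s' - s‖) (x := s) (y := s')
    (fun x hx => (hball x (hseg hx)).1.1.1.differentiable)
    (fun x hx => by
      have h1 := hK.norm_sub_le (hball x (hseg hx)).2 (hball s hsb).2
      refine h1.trans ?_
      gcongr
      have := norm_sub_le_of_mem_segment hx
      exact this)
    (convex_segment s s') (left_mem_segment ℝ s s') (right_mem_segment ℝ s s')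
  have ho1 := (hball s hsb).1.1
  have ho2 := (hball s' hs'b).1.1
  rw [ho1.1.zero hs, ho2.1.zero hs', sub_zero, zero_sub, norm_neg, Real.norm_eq_abs] at hest
  rw [nu_eq hD hs ho1, inner_unitN, abs_mul, abs_inv, abs_norm]
  have hl := (hball s hsb).1.2
  calc ‖fderiv ℝ f s‖⁻¹ * |fderiv ℝ f s (s' - s)|
      ≤ (‖fderiv ℝ f p‖ / 2)⁻¹ * (K * ‖s' - s‖ * ‖s' - s‖) := by
        gcongr
    _ = _ := by ring

lemma quad_global (hS : IsCompact S) (hD : ∀ p, LC S D p) :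
    ∃ C : ℝ, 0 < C ∧ ∀ s ∈ S, ∀ s' ∈ S,
      |inner ℝ (nu D s) (s' - s)| ≤ C * ‖s' - s‖ ^ 2 := by
  have key : ∃ C : ℝ, ∀ z ∈ S ×ˢ S, z.1 ∈ S → z.2 ∈ S →
      |inner ℝ (nu D z.1) (z.2 - z.1)| ≤ C * ‖z.2 - z.1‖ ^ 2 := by
    refine IsCompact.induction_on (p := fun T : Set (R3 × R3) => ∃ C : ℝ, ∀ z ∈ T, z.1 ∈ S →
      z.2 ∈ S → |inner ℝ (nu D z.1) (z.2 - z.1)| ≤ C * ‖z.2 - z.1‖ ^ 2) (hS.prod hS) ?_ ?_ ?_ ?_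
    · exact ⟨0, by simp⟩
    · rintro T T' hT ⟨C, hC⟩
      exact ⟨C, fun z hz => hC z (hT hz)⟩
    · rintro T T' ⟨C, hC⟩ ⟨C', hC'⟩
      refine ⟨max C C', ?_⟩
      rintro z (hz | hz) h1 h2
      · exact (hC z hz h1 h2).trans (by gcongr; exact le_max_left _ _)
      · exact (hC' z hz h1 h2).trans (by gcongr; exact le_max_right _ _)
    · rintro ⟨p, q⟩ ⟨hp, hq⟩
      by_cases hpq : p = q
      · subst hpq
        obtain ⟨C, hC⟩ := quad_local hD hp
        exact ⟨_, nhdsWithin_le_nhds hC, C, fun z hz h1 h2 => hz z.1 z.2 rfl h1 h2⟩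
      · have hpos : 0 < ‖q - p‖ := norm_pos_iff.2 (sub_ne_zero.2 (Ne.symm hpq))
        have hc : Continuous (fun z : R3 × R3 => ‖z.2 - z.1‖) := by fun_prop
        have hev : ∀ᶠ z in 𝓝 (p, q), ‖q - p‖ / 2 < ‖z.2 - z.1‖ :=
          hc.continuousAt.eventually (lt_mem_nhds (by simp only; linarith))
        refine ⟨_, nhdsWithin_le_nhds hev, (‖q - p‖ / 2)⁻¹, fun z hz h1 h2 => ?_⟩
        have hz' : ‖q - p‖ / 2 < ‖z.2 - z.1‖ := hz
        have h3 := abs_real_inner_le_norm (nu D z.1) (z.2 - z.1)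
        rw [(nu_spec hD h1).1, one_mul] at h3
        refine h3.trans ?_
        rw [inv_mul_eq_div, le_div_iff₀ (by linarith)]
        nlinarith
  obtain ⟨C, hC⟩ := key
  refine ⟨max C 1, by positivity, fun s hs s' hs' => ?_⟩
  exact (hC (s, s') ⟨hs, hs'⟩ hs hs').trans (by gcongr; exact le_max_left _ _)

/-- the normal map -/
def nmap (D : Set R3) (s : R3) (t : ℝ) : R3 := s + t • nu D s

lemma nmap_inj (hD : ∀ p, LC S D p) {C ε : ℝ}
    (hC : ∀ s ∈ S, ∀ s' ∈ S, |inner ℝ (nu D s) (s' - s)| ≤ C * ‖s' - s‖ ^ 2) (hC0 : 0 < C)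
    (hε : 2 * ε * C < 1) {s s' : R3} {t t' : ℝ} (hs : s ∈ S) (hs' : s' ∈ S) (ht : |t| ≤ ε)
    (ht' : |t'| ≤ ε) (h : nmap D s t = nmap D s' t') : s = s' ∧ t = t' := by
  have key : ∀ s ∈ S, ∀ s' ∈ S, ∀ t t', |t| ≤ ε → nmap D s t = nmap D s' t' → s ≠ s' →
      t ^ 2 < t' ^ 2 := by
    intro s hs s' hs' t t' ht h hne
    have h1 : (s' - s) - t • nu D s = - (t' • nu D s') := by
      simp only [nmap] at h
      have h0 : s' - s - t • nu D s = s' - (s + t • nu D s) := by abel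
      rw [h0, h]; abel
    have h2 : ‖(s' - s) - t • nu D s‖ ^ 2 = t' ^ 2 := by
      rw [h1, norm_neg, norm_smul, (nu_spec hD hs').1, mul_one, Real.norm_eq_abs, sq_abs]
    rw [norm_sub_sq_real, real_inner_smul_right, norm_smul, (nu_spec hD hs).1, mul_one,
      Real.norm_eq_abs, sq_abs, real_inner_comm] at h2
    have hpos : 0 < ‖s' - s‖ ^ 2 := by
      have : 0 < ‖s' - s‖ := norm_pos_iff.2 (sub_ne_zero.2 hne.symm)
      positivity
    have h3 := hC s hs s' hs'
    have h4 : t * inner ℝ (nu D s) (s' - s) ≤ ε * (C * ‖s' - s‖ ^ 2) := by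
      refine (le_abs_self _).trans ?_
      rw [abs_mul]
      have := (abs_nonneg t).trans ht
      gcongr
    nlinarith
  have hss : s = s' := by
    by_contra hne
    have h1 := key s hs s' hs' t t' ht h hne
    have h2 := key s' hs' s hs t' t ht' h.symm (Ne.symm hne)
    linarith
  refine ⟨hss, ?_⟩
  subst hss
  have hn : nu D s ≠ 0 := fun h0 => by
    have := (nu_spec hD hs).1; rw [h0] at this; simp at this
  have : t • nu D s = t' • nu D s := add_left_cancel h
  exact smul_left_injective ℝ hn this

lemma nearest (hS : IsCompact S) (hne : S.Nonempty) (hD : ∀ p, LC S D p) (x : R3) :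
    ∃ s ∈ S, ∃ t : ℝ, |t| = infDist x S ∧ x = nmap D s t := by
  obtain ⟨s, hs, hd⟩ := hS.exists_infDist_eq_dist hne x
  refine ⟨s, hs, ?_⟩
  by_cases hxs : x = s
  · subst hxs
    exact ⟨0, by rw [hd]; simp, by simp [nmap]⟩
  set d := dist x s with hdd
  have hd0 : 0 < d := dist_pos.2 hxs
  have hball : ∀ y ∈ ball x d, y ∉ S := by
    intro y hy hyS
    have := infDist_le_dist_of_mem (x := x) hyS
    rw [hd, dist_comm] at this
    exact absurd hy (not_lt.2 this)
  set a : R3 := d⁻¹ • (x - s) with ha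
  have ha1 : ‖a‖ = 1 := by
    rw [ha, norm_smul, ← dist_eq_norm, ← hdd, norm_inv, Real.norm_eq_abs, abs_of_pos hd0,
      inv_mul_cancel₀ hd0.ne']
  have hxa : x = s + d • a := by
    rw [ha, smul_smul, mul_inv_cancel₀ hd0.ne', one_smul]; abel
  have hin : ∀ w, 0 < inner ℝ a w → ∀ᶠ t in 𝓝[>] (0 : ℝ), s + t • w ∈ ball x d := by
    intro w hw
    have hlim : Tendsto (fun t : ℝ => t * ‖w‖ ^ 2) (𝓝[>] 0) (𝓝 (0 * ‖w‖ ^ 2)) :=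
      ((continuous_id.mul continuous_const).tendsto (0 : ℝ)).mono_left nhdsWithin_le_nhds
    rw [zero_mul] at hlim
    have hev := hlim.eventually (gt_mem_nhds (show 0 < 2 * d * inner ℝ a w by positivity))
    filter_upwards [hev, self_mem_nhdsWithin] with t ht ht0
    have ht0' : (0 : ℝ) < t := ht0
    rw [mem_ball_iff_norm]
    have h1 : s + t • w - x = t • w - d • a := by rw [hxa]; abel
    rw [h1]
    have h2 : ‖t • w - d • a‖ ^ 2 < d ^ 2 := by
      rw [norm_sub_sq_real, real_inner_smul_left, real_inner_smul_right, norm_smul, norm_smul, ha1,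
        mul_one, Real.norm_eq_abs, Real.norm_eq_abs, abs_of_pos hd0, abs_of_pos ht0',
        real_inner_comm]
      nlinarith
    exact lt_of_pow_lt_pow_left₀ 2 hd0.le h2
  rcases side_connected hS.isClosed hD (convex_ball x d).isPreconnected hball with h | h
  · have := (nu_spec hD hs).eq_of_half ha1 (fun w hw => (hin w hw).mono fun t ht => h ht)
    exact ⟨d, by rw [abs_of_pos hd0, hd], by rw [nmap, ← this]; exact hxa⟩
  · have := (nu_spec hD hs).eq_neg_of_half ha1 (fun w hw => (hin w hw).mono fun t ht => h _ ht)
    refine ⟨-d, by rw [abs_neg, abs_of_pos hd0, hd], ?_⟩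
    rw [nmap, neg_smul, ← smul_neg, ← this]; exact hxa

lemma nmap_side (hS : IsClosed S) (hD : ∀ p, LC S D p) {C ε : ℝ} (hε0 : 0 < ε)
    (hC : ∀ s ∈ S, ∀ s' ∈ S, |inner ℝ (nu D s) (s' - s)| ≤ C * ‖s' - s‖ ^ 2) (hC0 : 0 < C)
    (hε : 2 * ε * C < 1) {s : R3} {t : ℝ} (hs : s ∈ S) (ht : |t| ≤ ε) :
    nmap D s t ∈ D ↔ 0 < t := by
  have hav : ∀ τ, |τ| ≤ ε → τ ≠ 0 → nmap D s τ ∉ S := by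
    intro τ hτ hτ0 hmem
    have := nmap_inj hD hC hC0 hε (t' := 0) hs hmem hτ (by simpa using hε0.le)
      (by simp [nmap])
    exact hτ0 this.2
  have hn := nu_spec hD hs
  have hcont : Continuous (fun τ : ℝ => nmap D s τ) := by unfold nmap; fun_prop
  rcases lt_trichotomy t 0 with h | h | h
  · refine ⟨fun hmem => ?_, fun h2 => by linarith⟩
    exfalso
    have hpc : IsPreconnected ((fun τ : ℝ => nmap D s τ) '' Ico t 0) :=
      isPreconnected_Ico.image _ hcont.continuousOn
    have hsub : ∀ x ∈ (fun τ : ℝ => nmap D s τ) '' Ico t 0, x ∉ S := by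
      rintro _ ⟨τ, hτ, rfl⟩
      refine hav τ ?_ hτ.2.ne
      rw [abs_of_neg hτ.2]
      rw [abs_of_neg h] at ht
      linarith [hτ.1]
    rcases side_connected hS hD hpc hsub with h1 | h1
    · have h2 := hn.2.2 (-nu D s) (by
        rw [inner_neg_right, real_inner_self_eq_norm_sq, hn.1]; norm_num)
      have h3 : ∀ᶠ τ in 𝓝[>] (0 : ℝ), τ < -t :=
        nhdsWithin_le_nhds (gt_mem_nhds (by linarith))
      obtain ⟨τ, ⟨h4, h5⟩, h6⟩ := ((h2.and h3).and self_mem_nhdsWithin).exists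
      have h6' : (0 : ℝ) < τ := h6
      apply h4
      have := h1 ⟨-τ, ⟨by linarith, by linarith⟩, rfl⟩
      simpa [nmap] using this
    · exact h1 _ ⟨t, ⟨le_rfl, h⟩, rfl⟩ hmem
  · subst h
    simp only [nmap, zero_smul, add_zero, lt_irrefl, iff_false]
    exact side_notMem hD hs
  · refine ⟨fun _ => h, fun _ => ?_⟩
    have hpc : IsPreconnected ((fun τ : ℝ => nmap D s τ) '' Ioc 0 t) :=
      isPreconnected_Ioc.image _ hcont.continuousOn
    have hsub : ∀ x ∈ (fun τ : ℝ => nmap D s τ) '' Ioc 0 t, x ∉ S := by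
      rintro _ ⟨τ, hτ, rfl⟩
      refine hav τ ?_ hτ.1.ne'
      rw [abs_of_pos hτ.1]
      rw [abs_of_pos h] at ht
      linarith [hτ.2]
    rcases side_connected hS hD hpc hsub with h1 | h1
    · exact h1 ⟨t, ⟨h, le_rfl⟩, rfl⟩
    · exfalso
      have h2 := hn.2.1 (nu D s) (by
        rw [real_inner_self_eq_norm_sq, hn.1]; norm_num)
      have h3 : ∀ᶠ τ in 𝓝[>] (0 : ℝ), τ < t := nhdsWithin_le_nhds (gt_mem_nhds h)
      obtain ⟨τ, ⟨h4, h5⟩, h6⟩ := ((h2.and h3).and self_mem_nhdsWithin).exists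
      exact h1 _ ⟨τ, ⟨h6, h5.le⟩, rfl⟩ h4

end Side


section Collar
variable {S D : Set R3}

lemma closure_side (hS : IsClosed S) (hD : ∀ p, LC S D p) : closure D = D ∪ S := by
  apply subset_antisymm
  · have : IsClosed (D ∪ S) := isOpen_compl_iff.1 (side_ext_open hS hD)
    exact this.closure_subset_iff.2 subset_union_left
  · rintro s (hs | hs)
    · exact subset_closure hs
    · have hn := nu_spec hD hs
      have h1 := hn.2.1 (nu D s) (by rw [real_inner_self_eq_norm_sq, hn.1]; norm_num)
      have hc : Continuous (fun t : ℝ => s + t • nu D s) := by fun_prop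
      have hl : Tendsto (fun t : ℝ => s + t • nu D s) (𝓝[>] 0) (𝓝 s) := by
        have := (hc.tendsto 0).mono_left (nhdsWithin_le_nhds (s := Ioi 0))
        simpa using this
      exact mem_closure_of_tendsto hl h1

lemma frontier_side (hS : IsClosed S) (hD : ∀ p, LC S D p) : frontier D = S := by
  rw [(side_open hD).frontier_eq, closure_side hS hD]
  ext x
  constructor
  · rintro ⟨h1 | h1, h2⟩
    · exact absurd h1 h2
    · exact h1
  · exact fun h => ⟨Or.inr h, side_notMem hD h⟩

lemma frontier_closure_side (hS : IsClosed S) (hD : ∀ p, LC S D p) : frontier (closure D) = S := by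
  rw [frontier, closure_closure]
  ext x
  constructor
  · rintro ⟨h1, h2⟩
    rw [closure_side hS hD] at h1
    rcases h1 with h1 | h1
    · exact absurd (interior_maximal subset_closure (side_open hD) h1) h2
    · exact h1
  · intro hx
    refine ⟨by rw [closure_side hS hD]; exact Or.inr hx, fun hinn => ?_⟩
    obtain ⟨f, hf, h⟩ := (hD x).2 hx
    apply hf.2.1
    apply IsLocalMin.fderiv_eq_zero
    filter_upwards [h, hf.2.2, mem_interior_iff_mem_nhds.1 hinn] with y a b c
    rw [hf.zero hx]
    rw [closure_side hS hD] at c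
    rcases c with c | c
    · exact (a.1 c).le
    · exact (b.1 c).ge

/-- `(-ε, ε)` is homeomorphic to the positive half line, reversing the order -/
def ivHomeo {ε : ℝ} (hε : 0 < ε) : Ioo (-ε) ε ≃ₜ Ioi (0 : ℝ) where
  toFun t := ⟨(ε - t) / (ε + t), by
    have h1 : -ε < (t : ℝ) := t.2.1
    have h2 : (t : ℝ) < ε := t.2.2
    have h3 : 0 < ε - (t : ℝ) := by linarith
    have h4 : 0 < ε + (t : ℝ) := by linarith
    exact div_pos h3 h4⟩
  invFun r := ⟨ε * (1 - r) / (1 + r), by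
    have hr : (0 : ℝ) < r := r.2
    rw [lt_div_iff₀ (by linarith)]; nlinarith, by
    have hr : (0 : ℝ) < r := r.2
    rw [div_lt_iff₀ (by linarith)]; nlinarith⟩
  left_inv t := by
    apply Subtype.ext
    have hε' : ε ≠ 0 := hε.ne'
    have h0 : -ε < (t : ℝ) := t.2.1
    have h1 : ε + (t : ℝ) ≠ 0 := by linarith
    have h2 : 1 + (ε - (t : ℝ)) / (ε + t) = 2 * ε / (ε + t) := by
      field_simp; ring
    have h3 : 1 - (ε - (t : ℝ)) / (ε + t) = 2 * t / (ε + t) := by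
      field_simp; ring
    simp only
    rw [h2, h3]
    field_simp
  right_inv r := by
    apply Subtype.ext
    have hr : (0 : ℝ) < r := r.2
    have h1 : 1 + (r : ℝ) ≠ 0 := by linarith
    simp only
    field_simp
    ring
  continuous_toFun := by
    apply Continuous.subtype_mk
    apply Continuous.div (by fun_prop) (by fun_prop)
    intro t; linarith [t.2.1]
  continuous_invFun := by
    apply Continuous.subtype_mk
    apply Continuous.div (by fun_prop) (by fun_prop)
    intro r
    have hr : (0 : ℝ) < r := r.2
    linarith

theorem schoenflies_side (hS : IsCompact S) (e : S ≃ₜ Sphere2) (hDb : Bornology.IsBounded D)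
    (hD : ∀ p, LC S D p) : Nonempty (↥(closure D) ≃ₜ Ball3) := by
  obtain ⟨C, hC0, hC⟩ := quad_global hS hD
  obtain ⟨ε, hε0, hε⟩ : ∃ ε : ℝ, 0 < ε ∧ 2 * ε * C < 1 :=
    ⟨1 / (4 * C), by positivity, by field_simp; norm_num⟩
  obtain ⟨v0, hv0⟩ : ∃ v : R3, ‖v‖ = 1 := exists_norm_eq R3 zero_le_one
  have hne : S.Nonempty := ⟨_, (e.symm ⟨v0, hv0⟩).2⟩
  haveI : CompactSpace S := isCompact_iff_compactSpace.1 hS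
  have hnuc : Continuous (fun s : S => nu D s) := (nu_cont hD).domRestrict
  -- closed collar
  let ΦK : S × Icc (-ε) ε → R3 := fun z => nmap D z.1 z.2
  have hΦKc : Continuous ΦK := by
    have h1 : Continuous (fun z : S × Icc (-ε) ε => nu D z.1) := hnuc.comp continuous_fst
    have h2 : Continuous (fun z : S × Icc (-ε) ε => (z.2 : ℝ)) := by fun_prop
    have h3 : Continuous (fun z : S × Icc (-ε) ε => (z.1 : R3)) := by fun_prop
    exact h3.add (h2.smul h1)
  have hΦKi : Function.Injective ΦK := by
    rintro ⟨s, t⟩ ⟨s', t'⟩ h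
    have := nmap_inj hD hC hC0 hε s.2 s'.2 (abs_le.2 t.2) (abs_le.2 t'.2) h
    exact Prod.ext (Subtype.ext this.1) (Subtype.ext this.2)
  have hΦKe : IsClosedEmbedding ΦK := hΦKc.isClosedEmbedding hΦKi
  let ι : S × Ioo (-ε) ε → S × Icc (-ε) ε := Prod.map id (inclusion Ioo_subset_Icc_self)
  have hι : IsEmbedding ι := IsEmbedding.id.prodMap (IsEmbedding.inclusion _)
  let Φ : S × Ioo (-ε) ε → R3 := fun z => nmap D z.1 z.2
  have hΦe : IsEmbedding Φ := hΦKe.isEmbedding.comp hι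
  have hΦr : range Φ = {x | infDist x S < ε} := by
    ext x
    constructor
    · rintro ⟨⟨s, t⟩, rfl⟩
      have h1 := infDist_le_dist_of_mem (x := nmap D s t) s.2
      have h2 : dist (nmap D s t) s = |(t : ℝ)| := by
        rw [dist_eq_norm, nmap, add_sub_cancel_left, norm_smul, (nu_spec hD s.2).1, mul_one,
          Real.norm_eq_abs]
      exact h1.trans_lt (h2 ▸ abs_lt.2 t.2)
    · intro hx
      obtain ⟨s, hs, t, ht, hxt⟩ := nearest hS hne hD x
      have hx' : infDist x S < ε := hx
      rw [← ht] at hx'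
      exact ⟨(⟨s, hs⟩, ⟨t, abs_lt.1 hx'⟩), hxt.symm⟩
  have hΦo : IsOpenEmbedding Φ := ⟨hΦe, by
    rw [hΦr]; exact isOpen_Iio.preimage (continuous_infDist_pt S)⟩
  -- the model side
  let hsph : Sphere2 ≃ₜ sphere (0 : R3) 1 := Homeomorph.setCongr (by
    ext x; rw [mem_sphere_zero_iff_norm]; rfl)
  let Θh : S × Ioo (-ε) ε ≃ₜ ({0}ᶜ : Set R3) :=
    ((e.trans hsph).prodCongr (ivHomeo hε0)).trans (homeomorphUnitSphereProd R3).symm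
  let Θ : S × Ioo (-ε) ε → R3 := fun z => (Θh z : R3)
  have hΘo : IsOpenEmbedding Θ :=
    (isOpen_compl_singleton.isOpenEmbedding_subtypeVal).comp Θh.isOpenEmbedding
  have hΘr : range Θ = {0}ᶜ := by
    have : Θ = Subtype.val ∘ Θh := rfl
    rw [this, range_comp, Θh.surjective.range_eq, image_univ, Subtype.range_coe]
  have hΘn : ∀ z, ‖Θ z‖ = (ε - z.2) / (ε + z.2) := by
    intro z
    have hz : Θ z = (((ivHomeo hε0 z.2 : Ioi (0 : ℝ)) : ℝ)) • ((hsph (e z.1) : R3)) := rfl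
    rw [hz, norm_smul, norm_eq_of_mem_sphere, mul_one, Real.norm_eq_abs,
      abs_of_pos (ivHomeo hε0 z.2).2]
    rfl
  haveI : Nonempty (S × Ioo (-ε) ε) := ⟨(⟨_, hne.some_mem⟩, ⟨0, by simpa using hε0⟩)⟩
  let P : OpenPartialHomeomorph R3 R3 :=
    (hΦo.toOpenPartialHomeomorph Φ).symm.trans (hΘo.toOpenPartialHomeomorph Θ)
  have hPs : P.source = range Φ := by
    simp [P, OpenPartialHomeomorph.trans_source]
  have hPt : P.target = {0}ᶜ := by
    rw [← hΘr]
    simp [P, OpenPartialHomeomorph.trans_target]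
  have hPc : ∀ z, P (Φ z) = Θ z := by
    intro z
    have h1 : (hΦo.toOpenPartialHomeomorph Φ).symm (Φ z) = z :=
      (hΦo.toOpenPartialHomeomorph Φ).left_inv (by simp)
    simp only [P, OpenPartialHomeomorph.coe_trans, Function.comp_apply, h1]
    rfl
  have hfrD := frontier_side hS.isClosed hD
  refine schoenflies_top P hPt (side_open hD) hDb ?_ ?_ ?_
  · rw [hfrD, hPs, hΦr]
    intro x hx
    change infDist x S < ε
    rw [infDist_zero_of_mem hx]; exact hε0
  · intro x hx
    rw [hPs] at hx
    obtain ⟨z, rfl⟩ := hx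
    rw [hPc, hΘn]
    change _ ↔ nmap D z.1 z.2 ∈ D
    rw [nmap_side hS.isClosed hD hε0 hC hC0 hε z.1.2 (abs_lt.2 z.2.2).le,
      div_lt_one (by linarith [z.2.2.1])]
    constructor <;> intro h <;> linarith
  · intro x hx
    rw [hPs] at hx
    obtain ⟨z, rfl⟩ := hx
    rw [hPc, hΘn, hfrD, div_eq_one_iff_eq (by linarith [z.2.2.1])]
    change _ ↔ nmap D z.1 z.2 ∈ S
    constructor
    · intro h
      have h0 : (z.2 : ℝ) = 0 := by linarith
      rw [h0]; simp [nmap]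
    · intro h
      have := nmap_inj hD hC hC0 hε (t' := 0) z.1.2 h (abs_lt.2 z.2.2).le (by simpa using hε0.le)
        (by simp [nmap])
      rw [this.2]; ring

end Collar

lemma compl_interior_MofS {S : Set R3} (hS : IsSmoothSurface S) {T D : Set R3}
    (hT : IsClosed T) (hTS : T ⊆ interior (MofS S)) (hDb : Bornology.IsBounded D)
    (hD : ∀ p, LC T D p) : D ⊆ interior (MofS S) := by
  obtain ⟨R, hR, hSR, hDR⟩ : ∃ R > 0, S ⊆ closedBall (0 : R3) R ∧ D ⊆ closedBall (0 : R3) R := by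
    obtain ⟨R, h⟩ := hS.1.isBounded.subset_closedBall (0 : R3)
    obtain ⟨R', h'⟩ := hDb.subset_closedBall (0 : R3)
    refine ⟨max (max R R') 1, by positivity, h.trans (closedBall_subset_closedBall ?_),
      h'.trans (closedBall_subset_closedBall ?_)⟩
    · exact (le_max_left _ _).trans (le_max_left _ _)
    · exact (le_max_right _ _).trans (le_max_left _ _)
  have hSo : IsOpen Sᶜ := hS.1.isClosed.isOpen_compl
  set V : Set R3 := {x | ‖x‖ ∈ Ioi R} with hV
  have hVc : IsPreconnected V := norm_preconnected isPreconnected_Ioi fun r hr => hR.trans hr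
  have hVS : V ⊆ Sᶜ := fun x hx hxS => by
    have := hSR hxS
    rw [mem_closedBall_zero_iff] at this
    exact absurd this (not_le.2 hx)
  obtain ⟨x0, hx0⟩ : ∃ x : R3, ‖x‖ = R + 1 := exists_norm_eq R3 (by linarith)
  have hx0V : x0 ∈ V := by change R < ‖x0‖; linarith
  set W := connectedComponentIn Sᶜ x0 with hW
  have hVW : V ⊆ W := hVc.subset_connectedComponentIn hx0V hVS
  have hWo : IsOpen W := hSo.connectedComponentIn
  have hVunb : ∀ A : Set R3, V ⊆ A → ¬ Bornology.IsBounded A := by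
    intro A hA hb
    obtain ⟨r, hr⟩ := hb.subset_closedBall (0 : R3)
    obtain ⟨y, hy⟩ : ∃ y : R3, ‖y‖ = max r R + 1 := exists_norm_eq R3 (by positivity)
    have h1 : y ∈ V := by
      change R < ‖y‖; rw [hy]; linarith [le_max_right r R]
    have h2 := hr (hA h1)
    rw [mem_closedBall_zero_iff, hy] at h2
    linarith [le_max_left r R]
  -- points off `S` are bounded or in `W`
  have hdich : ∀ p, p ∉ S → p ∉ W → p ∈ boundedRegion S := by
    intro p hp hpW
    refine ⟨hp, (isBounded_closedBall (x := (0 : R3)) (r := R)).subset ?_⟩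
    intro y hy
    rw [mem_closedBall_zero_iff]
    by_contra h
    have hyV : y ∈ V := not_le.1 h
    apply hpW
    have h1 : connectedComponentIn Sᶜ p = connectedComponentIn Sᶜ y := connectedComponentIn_eq hy
    have h2 : W = connectedComponentIn Sᶜ y := connectedComponentIn_eq (hVW hyV)
    rw [h2, ← h1]
    exact mem_connectedComponentIn hp
  have hWb : ∀ p ∈ W, p ∉ boundedRegion S := by
    intro p hp hpb
    have h1 : W = connectedComponentIn Sᶜ p := connectedComponentIn_eq hp
    apply hVunb _ hVW
    rw [h1]; exact hpb.2
  have hWM : ∀ p ∈ W, p ∉ MofS S := by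
    intro p hp hpM
    obtain ⟨y, hy1, hy2⟩ := mem_closure_iff.1 hpM W hWo hp
    exact hWb y hy1 hy2
  set C0 : Set R3 := (interior (MofS S))ᶜ with hC0
  have hWC : W ⊆ C0 := fun p hp h => hWM p hp (interior_subset h)
  have hCW : C0 ⊆ closure W := by
    intro p hp
    by_contra h
    apply hp
    -- the complement of `closure W` lies in `M`
    have hsub : (closure W)ᶜ ⊆ MofS S := by
      intro y hy
      rw [MofS, mem_closure_iff_nhds]
      intro N hN
      by_contra hcon
      have hev : ∀ᶠ z in 𝓝 y, z ∈ S := by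
        filter_upwards [hN, isClosed_closure.isOpen_compl.mem_nhds hy] with z hz1 hz2
        by_contra hzS
        exact hcon ⟨z, hz1, hdich z hzS fun hzW => hz2 (subset_closure hzW)⟩
      have : y ∈ interior S := mem_interior_iff_mem_nhds.2 hev
      rw [hS.interior_empty] at this
      exact this
    exact interior_maximal hsub isClosed_closure.isOpen_compl h
  have hC0c : IsPreconnected C0 :=
    isPreconnected_connectedComponentIn.subset_closure hWC hCW
  have hC0T : ∀ x ∈ C0, x ∉ T := fun x hx hxT => hx (hTS hxT)
  rcases side_connected hT hD hC0c hC0T with h | h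
  · exfalso
    exact hVunb D ((hVW.trans hWC).trans h) hDb
  · intro x hx
    by_contra hc
    exact h x hc hx

/-- For any smoothly embedded compact, orientable,
boundaryless (connected) surface `S` in `ℝ³`, the manifold `M(S)` is
irreducible: every embedded two-sphere contained in the interior of `M(S)`
bounds an embedded three-ball inside the interior of `M(S)`. -/
theorem MofS_irreducible
    (S : Set R3) (hS : IsSmoothSurface S) (hconn : IsConnected S)
    (S' : Set R3) (hS' : IsEmbSphere S') (hsub : S' ⊆ interior (MofS S)) :
    BoundsBallIn S' (interior (MofS S)) := by
  obtain ⟨hS1, ⟨e⟩⟩ := hS'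
  obtain ⟨D, hDb, hD⟩ := exists_side hS1
  have hcl := hS1.1.isClosed
  have hDM := compl_interior_MofS hS hcl hsub hDb hD
  refine ⟨closure D, ?_, hDb.isCompact_closure, schoenflies_side hS1.1 e hDb hD,
    frontier_closure_side hcl hD⟩
  rw [closure_side hcl hD]
  exact union_subset hDM hsub
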